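/- arXiv:2408.05180 — 5 statements merged into one kernel-verified Lean document; each statement's English description precedes it below -/
import Mathlib

section
/- Let S be a nearly abelian semigroup of non-constant entire maps with commutator set K(S), and let G(S) be the group generated by K(S) inside the affine group of ℂ. Then the semigroup T(S) generated under composition by S together with G(S) is right amenable. -/
open Function

noncomputable section

/-- A semigroup `M` is right amenable if it carries a right-invariant finitely additive
probability measure defined on all subsets of `M`. -/
def RightAmenable (M : Type*) [Mul M] : Prop :=
  ∃ μ : Set M → ℝ,
    (∀ A : Set M, 0 ≤ μ A) ∧
    μ Set.univ = 1 ∧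
    (∀ A B : Set M, Disjoint A B → μ (A ∪ B) = μ A + μ B) ∧
    (∀ (γ : M) (A : Set M), μ {s : M | s * γ ∈ A} = μ A)

/-- `γ : ℂ → ℂ` is an invertible affine map `z ↦ a z + b` with `a ≠ 0`. -/
def IsAffine (γ : ℂ → ℂ) : Prop :=
  ∃ a b : ℂ, a ≠ 0 ∧ ∀ z : ℂ, γ z = a * z + b

/-- `S` is a nearly abelian semigroup of non-constant entire maps : every element is a
non-constant entire map and for every pair `f, g ∈ S` there is an affine `γ` with
`f ∘ g = γ ∘ g ∘ f`.  (Here `Function.End ℂ` is `ℂ → ℂ` under composition.) -/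
def NearlyAbelian (S : Subsemigroup (Function.End ℂ)) : Prop :=
  (∀ f ∈ S, Differentiable ℂ (f : ℂ → ℂ) ∧ ¬ ∃ c : ℂ, ∀ z : ℂ, (f : ℂ → ℂ) z = c) ∧
  ∀ f ∈ S, ∀ g ∈ S, ∃ γ : Function.End ℂ, IsAffine γ ∧ f * g = γ * (g * f)

/-- The commutator set `K(S)` of a nearly abelian semigroup : the set of affine maps `γ`
with `f ∘ g = γ ∘ g ∘ f` for some pair `f, g ∈ S`. -/
def naCommutatorSet (S : Subsemigroup (Function.End ℂ)) : Set (Function.End ℂ) :=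
  {γ : Function.End ℂ | IsAffine γ ∧ ∃ f ∈ S, ∃ g ∈ S, f * g = γ * (g * f)}

/-- The group `G(S)` generated by the commutator set `K(S)` inside the affine group of `ℂ`,
realised as the submonoid of `Function.End ℂ` generated by `K(S)` together with the
(two-sided, affine) inverses of the elements of `K(S)`. -/
def naCommutatorGroup (S : Subsemigroup (Function.End ℂ)) : Submonoid (Function.End ℂ) :=
  Submonoid.closure
    (naCommutatorSet S ∪
      {γ : Function.End ℂ | ∃ δ ∈ naCommutatorSet S, γ * δ = 1 ∧ δ * γ = 1})

/-- The semigroup `T(S)` generated by `S` together with `G(S)`. -/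
def TSemigroup (S : Subsemigroup (Function.End ℂ)) : Subsemigroup (Function.End ℂ) :=
  Subsemigroup.closure
    ((S : Set (Function.End ℂ)) ∪ (naCommutatorGroup S : Set (Function.End ℂ)))


/-- With respect to a family `ev` of linear functionals, thought of as evaluations at points, the
operator `T` preserves all constant lower bounds. -/
def PreservesLowerBounds {X V : Type*} [AddCommGroup V] [Module ℝ V] (ev : X → V →ₗ[ℝ] ℝ)
    (T : Module.End ℝ V) : Prop :=
  ∀ (v : V) (c : ℝ), (∀ x, c ≤ ev x v) → ∀ x, c ≤ ev x (T v)

/-- The Cesàro average of the first `n + 1` powers of an operator. -/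
def cesaroAverage {V : Type*} [AddCommGroup V] [Module ℝ V] (T : Module.End ℝ V) (n : ℕ) :
    Module.End ℝ V :=
  ((n : ℝ) + 1)⁻¹ • ∑ i ∈ Finset.range (n + 1), T ^ i

theorem Commute.cesaroAverage {V : Type*} [AddCommGroup V] [Module ℝ V]
    {T U : Module.End ℝ V} (h : Commute T U) (m n : ℕ) :
    Commute (cesaroAverage T m) (cesaroAverage U n) := by
  refine Commute.smul_left (Commute.smul_right ?_ _) _
  exact Commute.sum_left _ _ _ fun i _ => Commute.sum_right _ _ _ fun j _ => h.pow_pow i j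

theorem cesaroAverage_apply_sub {V : Type*} [AddCommGroup V] [Module ℝ V]
    (T : Module.End ℝ V) (n : ℕ) (v : V) :
    cesaroAverage T n (v - T v) = ((n : ℝ) + 1)⁻¹ • (v - (T ^ (n + 1)) v) := by
  have h := congrArg (fun A : Module.End ℝ V => -(A v)) (geom_sum_mul T (n + 1))
  simp only [Module.End.mul_apply, LinearMap.sub_apply, Module.End.one_apply, map_sub,
    neg_sub] at h
  simp only [cesaroAverage, LinearMap.smul_apply, map_sub]
  rw [← smul_sub, h]

namespace PreservesLowerBounds

variable {X V : Type*} [AddCommGroup V] [Module ℝ V] {ev : X → V →ₗ[ℝ] ℝ} {T U : Module.End ℝ V}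

theorem one : PreservesLowerBounds ev 1 := fun _ _ h => h

theorem mul (hT : PreservesLowerBounds ev T) (hU : PreservesLowerBounds ev U) :
    PreservesLowerBounds ev (T * U) := fun v c h => hT _ c (hU v c h)

theorem pow (hT : PreservesLowerBounds ev T) : ∀ n : ℕ, PreservesLowerBounds ev (T ^ n)
  | 0 => by simpa using one
  | n + 1 => by simpa only [pow_succ] using (pow hT n).mul hT

theorem abs_le (hT : PreservesLowerBounds ev T) (v : V) (c : ℝ)
    (h : ∀ x, |ev x v| ≤ c) (x : X) : |ev x (T v)| ≤ c := by
  have h₁ := hT v (-c) (fun x => (_root_.abs_le.1 (h x)).1) x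
  have h₂ := hT (-v) (-c) (fun x => by
    simpa using (_root_.abs_le.1 (h x)).2) x
  rw [map_neg, map_neg] at h₂
  exact _root_.abs_le.2 ⟨h₁, by linarith⟩

theorem cesaroAverage (hT : PreservesLowerBounds ev T) (n : ℕ) :
    PreservesLowerBounds ev (cesaroAverage T n) := by
  intro v c h x
  have hn : (0 : ℝ) < (n : ℝ) + 1 := by positivity
  have hs : ((n : ℝ) + 1) * c ≤ ∑ i ∈ Finset.range (n + 1), ev x ((T ^ i) v) := by
    simpa using Finset.card_nsmul_le_sum (Finset.range (n + 1))
      (fun i => ev x ((T ^ i) v)) c (fun i _ => hT.pow i v c h x)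
  have he : ev x (_root_.cesaroAverage T n v) =
      ((n : ℝ) + 1)⁻¹ * ∑ i ∈ Finset.range (n + 1), ev x ((T ^ i) v) := by
    simp [_root_.cesaroAverage, LinearMap.sum_apply]
  rw [he, ← div_eq_inv_mul, le_div_iff₀ hn]
  linarith

end PreservesLowerBounds

/-- A commuting family of positive unital operators on a space of bounded functions has an
invariant positive normalised functional. -/
theorem exists_invariant_functional {X V ι : Type*} [Nonempty X] [NormedAddCommGroup V]
    [NormedSpace ℝ V] (ev : X → V →ₗ[ℝ] ℝ) (hle : ∀ x v, |ev x v| ≤ ‖v‖)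
    (hnorm : ∀ v c, 0 ≤ c → (∀ x, |ev x v| ≤ c) → ‖v‖ ≤ c) (e : V) (he : ∀ x, ev x e = 1)
    (R : ι → Module.End ℝ V) (hcomm : ∀ i j, Commute (R i) (R j))
    (hR : ∀ i, PreservesLowerBounds ev (R i)) :
    ∃ m : V →ₗ[ℝ] ℝ, (∀ v, (∀ x, 0 ≤ ev x v) → 0 ≤ m v) ∧ m e = 1 ∧
      ∀ i v, m (R i v) = m v := by
  let C : Submonoid (Module.End ℝ V) :=
    Submonoid.closure (Set.range fun p : ι × ℕ => cesaroAverage (R p.1) p.2)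
  have hC : ∀ T ∈ C, PreservesLowerBounds ev T := by
    intro T hT
    induction hT using Submonoid.closure_induction with
    | mem T hT => obtain ⟨p, rfl⟩ := hT; exact (hR _).cesaroAverage _
    | one => exact .one
    | mul T U _ _ hT hU => exact hT.mul hU
  have hCcomm : ∀ T ∈ C, ∀ U ∈ C, Commute T U := by
    intro T hT U hU
    induction hT, hU using Submonoid.closure_induction₂ with
    | mem T U hT hU =>
      obtain ⟨p, rfl⟩ := hT
      obtain ⟨q, rfl⟩ := hU
      exact (hcomm _ _).cesaroAverage _ _
    | one_left => exact Commute.one_left _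
    | one_right => exact Commute.one_right _
    | mul_left _ _ _ _ _ _ h₁ h₂ => exact h₁.mul_left h₂
    | mul_right _ _ _ _ _ _ h₁ h₂ => exact h₁.mul_right h₂
  let D : Submodule ℝ V :=
    { carrier := {d | ∀ ε > 0, ∃ T ∈ C, ∀ x, |ev x (T d)| ≤ ε}
      zero_mem' := fun ε hε => ⟨1, C.one_mem, fun x => by simpa using hε.le⟩
      add_mem' := by
        intro d e hd he ε hε
        obtain ⟨T, hT, hTd⟩ := hd (ε / 2) (by positivity)
        obtain ⟨U, hU, hUe⟩ := he (ε / 2) (by positivity)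
        refine ⟨T * U, C.mul_mem hT hU, fun x => ?_⟩
        have h₁ : (T * U) d = U (T d) := by rw [(hCcomm T hT U hU).eq]; rfl
        have h₂ := (hC U hU).abs_le _ _ hTd x
        have h₃ := (hC T hT).abs_le _ _ hUe x
        rw [map_add, h₁, Module.End.mul_apply, map_add]
        exact (abs_add_le _ _).trans (by linarith)
      smul_mem' := by
        intro c d hd ε hε
        obtain ⟨T, hT, hTd⟩ := hd (ε / (|c| + 1)) (by positivity)
        refine ⟨T, hT, fun x => ?_⟩
        have h := hTd x
        rw [le_div_iff₀ (by positivity)] at h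
        rw [map_smul, map_smul, smul_eq_mul, abs_mul]
        nlinarith [abs_nonneg (ev x (T d))] }
  have hD : ∀ i v, v - R i v ∈ D := by
    intro i v ε hε
    obtain ⟨n, hn⟩ := exists_nat_gt (2 * ‖v‖ / ε)
    rw [div_lt_iff₀ hε] at hn
    refine ⟨cesaroAverage (R i) n, Submonoid.subset_closure ⟨(i, n), rfl⟩, fun x => ?_⟩
    have h₁ := hle x v
    have h₂ := ((hR i).pow (n + 1)).abs_le v _ (hle · v) x
    rw [cesaroAverage_apply_sub, map_smul, map_sub, smul_eq_mul, abs_mul,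
      abs_of_pos (by positivity), ← div_eq_inv_mul, div_le_iff₀ (by positivity)]
    refine (abs_sub _ _).trans ?_
    nlinarith
  have hdisj : Disjoint (Metric.ball e 1) (D : Set V) := by
    rw [Set.disjoint_left]
    intro d hd hdD
    rw [mem_ball_iff_norm] at hd
    have hlow : ∀ x, 1 - ‖d - e‖ ≤ ev x d := by
      intro x
      have h := (abs_le.1 (hle x (d - e))).1
      rw [map_sub, he] at h
      linarith
    obtain ⟨T, hT, hTd⟩ := hdD ((1 - ‖d - e‖) / 2) (by linarith)
    obtain ⟨x⟩ := ‹Nonempty X›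
    have h₁ := hC T hT d _ hlow x
    have h₂ := (abs_le.1 (hTd x)).2
    linarith
  obtain ⟨f, u, hfu, huf⟩ := geometric_hahn_banach_open (convex_ball e 1) Metric.isOpen_ball
    D.convex hdisj
  have hu : u ≤ 0 := by simpa using huf 0 D.zero_mem
  have hf0 : ∀ d ∈ D, f d = 0 := by
    intro d hd
    by_contra hne
    have h := huf (((u - 1) / f d) • d) (D.smul_mem _ hd)
    rw [map_smul, smul_eq_mul, div_mul_cancel₀ _ hne] at h
    linarith
  have hfe : f e < 0 := (hfu e (Metric.mem_ball_self one_pos)).trans_le hu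
  have hfpos : ∀ v, (∀ x, 0 ≤ ev x v) → f v ≤ 0 := by
    intro v hv
    by_contra! hpos
    obtain ⟨c, hc⟩ := exists_nat_gt (-f e / f v)
    rw [div_lt_iff₀ hpos] at hc
    set w : V := e + (c : ℝ) • v with hw
    have hwpos : 0 < f w := by rw [hw, map_add, map_smul, smul_eq_mul]; linarith
    have hw1 : ∀ x, 1 ≤ ev x w := by
      intro x
      have := mul_nonneg (Nat.cast_nonneg (α := ℝ) c) (hv x)
      simpa [hw, he] using this
    have hwn : ∀ x, ev x w ≤ ‖w‖ := fun x => (le_abs_self _).trans (hle x w)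
    obtain ⟨x₀⟩ := id ‹Nonempty X›
    have hN : 1 ≤ ‖w‖ := (hw1 x₀).trans (hwn x₀)
    have hi : 0 < ‖w‖⁻¹ := by positivity
    have hmem : ‖w‖⁻¹ • w ∈ Metric.ball e 1 := by
      rw [mem_ball_iff_norm]
      have hN1 : ‖w‖⁻¹ ≤ 1 := inv_le_one_of_one_le₀ hN
      refine (hnorm _ (1 - ‖w‖⁻¹) (by linarith) fun x => ?_).trans_lt (by linarith)
      have h₁ := mul_le_mul_of_nonneg_left (hw1 x) hi.le
      have h₂ := mul_le_mul_of_nonneg_left (hwn x) hi.le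
      rw [inv_mul_cancel₀ (by positivity)] at h₂
      rw [map_sub, map_smul, he, smul_eq_mul, abs_le]
      constructor <;> linarith
    have h := (hfu _ hmem).trans_le hu
    rw [map_smul, smul_eq_mul] at h
    have := mul_pos hi hwpos
    linarith
  refine ⟨(f e)⁻¹ • f.toLinearMap, fun v hv => ?_, ?_, fun i v => ?_⟩
  · exact mul_nonneg_of_nonpos_of_nonpos (inv_nonpos.2 hfe.le) (hfpos v hv)
  · exact inv_mul_cancel₀ hfe.ne
  · have h := hf0 _ (hD i v)
    rw [map_sub, sub_eq_zero] at h
    simp [h]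

open scoped BoundedContinuousFunction

/-- Precomposition of bounded functions on discrete spaces with an arbitrary map. -/
def boundedPullback {X Y : Type*} [TopologicalSpace X] [DiscreteTopology X] [TopologicalSpace Y]
    (φ : X → Y) : (Y →ᵇ ℝ) →ₗ[ℝ] X →ᵇ ℝ where
  toFun f := f.compContinuous ⟨φ, continuous_of_discreteTopology⟩
  map_add' _ _ := rfl
  map_smul' _ _ := rfl

@[simp]
theorem boundedPullback_apply {X Y : Type*} [TopologicalSpace X] [DiscreteTopology X]
    [TopologicalSpace Y] (φ : X → Y) (f : Y →ᵇ ℝ) (x : X) :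
    boundedPullback φ f x = f (φ x) := rfl

/-- A positive normalised functional on the bounded functions. -/
structure IsMean {X : Type*} [TopologicalSpace X] (m : (X →ᵇ ℝ) →ₗ[ℝ] ℝ) : Prop where
  nonneg : ∀ f : X →ᵇ ℝ, (∀ x, 0 ≤ f x) → 0 ≤ m f
  one : m 1 = 1

namespace IsMean

variable {X : Type*} [TopologicalSpace X] {m : (X →ᵇ ℝ) →ₗ[ℝ] ℝ}

theorem le_of_forall_le (hm : IsMean m) {f : X →ᵇ ℝ} {c : ℝ} (h : ∀ x, f x ≤ c) : m f ≤ c := by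
  have := hm.nonneg (c • 1 - f) fun x => by simpa using h x
  rw [map_sub, map_smul, hm.one, smul_eq_mul] at this
  linarith

theorem abs_le (hm : IsMean m) (f : X →ᵇ ℝ) : |m f| ≤ ‖f‖ := by
  refine abs_le'.2 ⟨hm.le_of_forall_le fun x => (le_abs_self _).trans (f.norm_coe_le_norm x), ?_⟩
  rw [← map_neg]
  exact hm.le_of_forall_le fun x => (neg_le_abs _).trans (f.norm_coe_le_norm x)

end IsMean

/-- Existence of a mean on the bounded functions on `M` invariant under right translations. -/
def HasRightInvariantMean (M : Type*) [Mul M] [TopologicalSpace M] [DiscreteTopology M] : Prop :=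
  ∃ m : (M →ᵇ ℝ) →ₗ[ℝ] ℝ, IsMean m ∧ ∀ a f, m (boundedPullback (· * a) f) = m f

theorem HasRightInvariantMean.rightAmenable {M : Type*} [Mul M] [TopologicalSpace M]
    [DiscreteTopology M] (h : HasRightInvariantMean M) : RightAmenable M := by
  obtain ⟨m, hm, hinv⟩ := h
  let χ (A : Set M) : M →ᵇ ℝ :=
    BoundedContinuousFunction.ofNormedAddCommGroupDiscrete (A.indicator 1) 1 fun x => by
      by_cases hx : x ∈ A <;> simp [hx]
  refine ⟨fun A => m (χ A), fun A => hm.nonneg _ fun x => ?_, ?_, fun A B hAB => ?_,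
    fun a A => ?_⟩
  · exact Set.indicator_nonneg (fun _ _ => zero_le_one) x
  · have h : χ Set.univ = 1 := by
      ext x
      simp [χ]
    exact (congrArg m h).trans hm.one
  · have h : χ (A ∪ B) = χ A + χ B := by
      ext x
      simp [χ, Set.indicator_union_of_disjoint hAB]
    exact (congrArg m h).trans (map_add m _ _)
  · exact hinv a (χ A)

theorem hasRightInvariantMean_of_unique (M : Type*) [Mul M] [Unique M] [TopologicalSpace M]
    [DiscreteTopology M] : HasRightInvariantMean M := by
  refine ⟨{ toFun := fun f => f default, map_add' := fun _ _ => rfl, map_smul' := fun _ _ => rfl },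
    ⟨fun f h => h _, rfl⟩, fun a f => ?_⟩
  exact congrArg f (Subsingleton.elim _ _)

/-- A semigroup whose multiplication is commutative up to left multiplication by the image of an
amenable semigroup has a right invariant mean. -/
theorem HasRightInvariantMean.of_comm_mod {M N : Type*} [Semigroup M] [Nonempty M]
    [TopologicalSpace M] [DiscreteTopology M] [Mul N] [TopologicalSpace N] [DiscreteTopology N]
    (hN : HasRightInvariantMean N) (i : N →ₙ* M)
    (h : ∀ t a b : M, ∃ n, t * (a * b) = i n * (t * (b * a))) : HasRightInvariantMean M := by
  obtain ⟨mN, hmN, hinv⟩ := hN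
  let W : Submodule ℝ (M →ᵇ ℝ) :=
    { carrier := {F | ∀ n t, F (i n * t) = F t}
      zero_mem' := fun _ _ => rfl
      add_mem' := fun hF hG n t => congrArg₂ (· + ·) (hF n t) (hG n t)
      smul_mem' := fun c F hF n t => congrArg (c * ·) (hF n t) }
  let P : (M →ᵇ ℝ) →ₗ[ℝ] W :=
    { toFun := fun f =>
        ⟨BoundedContinuousFunction.ofNormedAddCommGroupDiscrete
          (fun t => mN (boundedPullback (fun n => i n * t) f)) ‖f‖ fun t =>
            (hmN.abs_le _).trans ((BoundedContinuousFunction.norm_le (norm_nonneg _)).2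
              fun n => f.norm_coe_le_norm _), fun n t => by
          change mN _ = mN _
          rw [← hinv n (boundedPullback (fun n => i n * t) f)]
          congr 1
          ext n'
          simp [mul_assoc]⟩
      map_add' := fun f g => by
        ext t
        exact map_add mN (boundedPullback (fun n => i n * t) f) (boundedPullback (fun n => i n * t) g)
      map_smul' := fun c f => by
        ext t
        exact map_smul mN c (boundedPullback (fun n => i n * t) f) }
  have hP : ∀ f t, (P f : M →ᵇ ℝ) t = mN (boundedPullback (fun n => i n * t) f) :=
    fun _ _ => rfl
  let R (a : M) : Module.End ℝ W := (boundedPullback (· * a)).restrict fun F hF n t => by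
    change F (i n * t * a) = F (t * a)
    rw [mul_assoc]
    exact hF n _
  have hR : ∀ a (F : W) t, (R a F : M →ᵇ ℝ) t = (F : M →ᵇ ℝ) (t * a) := fun _ _ _ => rfl
  let ev (t : M) : W →ₗ[ℝ] ℝ :=
    { toFun := fun F => (F : M →ᵇ ℝ) t
      map_add' := fun _ _ => rfl
      map_smul' := fun _ _ => rfl }
  let e : W := ⟨1, fun _ _ => rfl⟩
  have hcomm : ∀ a b, Commute (R a) (R b) := by
    intro a b
    ext F t
    obtain ⟨n, hn⟩ := h t a b
    change (F : M →ᵇ ℝ) (t * a * b) = (F : M →ᵇ ℝ) (t * b * a)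
    rw [mul_assoc, mul_assoc, hn]
    exact F.2 n _
  have hlow : ∀ a, PreservesLowerBounds (V := W) ev (R a) :=
    fun a F c hF t => hF (t * a)
  obtain ⟨m, hpos, hone, hm⟩ := exists_invariant_functional (V := W) ev
    (fun t F => (F : M →ᵇ ℝ).norm_coe_le_norm t)
    (fun F c hc hF => (BoundedContinuousFunction.norm_le hc).2 hF)
    e (fun _ => rfl) R hcomm hlow
  refine ⟨m ∘ₗ P, ⟨fun f hf => hpos _ fun t => hmN.nonneg _ fun n => hf _, ?_⟩, fun a f => ?_⟩
  · rw [LinearMap.comp_apply, ← hone]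
    congr 1
    ext t
    exact hmN.one
  · rw [LinearMap.comp_apply, LinearMap.comp_apply, ← hm a (P f)]
    congr 1
    ext t
    rw [hR, hP, hP]
    congr 1
    ext n
    simp [mul_assoc]

theorem isAffine_mul {f g : Function.End ℂ} (hf : IsAffine f) (hg : IsAffine g) :
    IsAffine (f * g : Function.End ℂ) := by
  obtain ⟨a, b, ha, hf⟩ := hf
  obtain ⟨c, d, hc, hg⟩ := hg
  refine ⟨a * c, a * d + b, mul_ne_zero ha hc, fun z => ?_⟩
  change f (g z) = _
  rw [hg, hf]
  ring

theorem IsAffine.exists_inverse {f : Function.End ℂ} (hf : IsAffine f) :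
    ∃ g : Function.End ℂ, IsAffine g ∧ g * f = 1 ∧ f * g = 1 := by
  obtain ⟨a, b, ha, hf⟩ := hf
  refine ⟨fun z => a⁻¹ * z + -(a⁻¹ * b), ⟨a⁻¹, _, inv_ne_zero ha, fun _ => rfl⟩, ?_, ?_⟩
  · funext z
    change a⁻¹ * f z + -(a⁻¹ * b) = z
    rw [hf]
    field_simp
    ring
  · funext z
    change f (a⁻¹ * z + -(a⁻¹ * b)) = z
    rw [hf]
    field_simp
    ring

theorem IsAffine.differentiable {f : ℂ → ℂ} (hf : IsAffine f) : Differentiable ℂ f := by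
  obtain ⟨a, b, -, hf⟩ := hf
  rw [funext hf]
  fun_prop

/-- Non-constant entire maps can be cancelled on the right among entire maps. -/
theorem entire_right_cancel {u v w : Function.End ℂ} (hu : Differentiable ℂ (u : ℂ → ℂ))
    (hv : Differentiable ℂ (v : ℂ → ℂ)) (hw : Differentiable ℂ (w : ℂ → ℂ))
    (hwc : ¬ ∃ c : ℂ, ∀ z : ℂ, (w : ℂ → ℂ) z = c) (h : u * w = v * w) : u = v := by
  have hopen : IsOpenMap (w : ℂ → ℂ) :=
    (AnalyticOnNhd.is_constant_or_isOpenMap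
      (Complex.analyticOnNhd_univ_iff_differentiable.2 hw)).resolve_left hwc
  refine AnalyticOnNhd.eq_of_eventuallyEq (Complex.analyticOnNhd_univ_iff_differentiable.2 hu)
    (Complex.analyticOnNhd_univ_iff_differentiable.2 hv) (z₀ := w 0) ?_
  filter_upwards [hopen.isOpen_range.mem_nhds ⟨0, rfl⟩]
  rintro _ ⟨z, rfl⟩
  exact congrFun h z

section CommutatorGroup

variable {S : Subsemigroup (Function.End ℂ)}

theorem isAffine_of_mem_naCommutatorGroup {γ : Function.End ℂ} (hγ : γ ∈ naCommutatorGroup S) :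
    IsAffine γ := by
  induction hγ using Submonoid.closure_induction with
  | mem γ hγ =>
    obtain hγ | ⟨δ, hδ, h₁, h₂⟩ := hγ
    · exact hγ.1
    · obtain ⟨ε, hε, -, h₄⟩ := hδ.1.exists_inverse
      rwa [left_inv_eq_right_inv h₁ h₄]
  | one => exact ⟨1, 0, one_ne_zero, fun z => show z = 1 * z + 0 by simp⟩
  | mul _ _ _ _ h₁ h₂ => exact isAffine_mul h₁ h₂

theorem exists_inverse_mem_naCommutatorGroup {γ : Function.End ℂ}
    (hγ : γ ∈ naCommutatorGroup S) : ∃ δ ∈ naCommutatorGroup S, δ * γ = 1 ∧ γ * δ = 1 := by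
  induction hγ using Submonoid.closure_induction with
  | mem γ hγ =>
    obtain hγ | ⟨δ, hδ, h₁, h₂⟩ := hγ
    · obtain ⟨δ, -, h₁, h₂⟩ := hγ.1.exists_inverse
      exact ⟨δ, Submonoid.subset_closure (Or.inr ⟨γ, hγ, h₁, h₂⟩), h₁, h₂⟩
    · exact ⟨δ, Submonoid.subset_closure (Or.inl hδ), h₂, h₁⟩
  | one => exact ⟨1, one_mem _, one_mul _, one_mul _⟩
  | mul γ₁ γ₂ _ _ h₁ h₂ =>
    obtain ⟨δ₁, hδ₁, h₁, hright₁⟩ := h₁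
    obtain ⟨δ₂, hδ₂, h₂, hright₂⟩ := h₂
    refine ⟨δ₂ * δ₁, mul_mem hδ₂ hδ₁, ?_, ?_⟩
    · rw [mul_assoc, ← mul_assoc δ₁, h₁, one_mul, h₂]
    · rw [mul_assoc, ← mul_assoc γ₂, hright₂, one_mul, hright₁]

/-- `t` can be moved past every element of the submonoid `G`, from left to right. -/
def Normalizes {E : Type*} [Monoid E] (G : Submonoid E) (t : E) : Prop :=
  ∀ γ ∈ G, ∃ γ' ∈ G, t * γ = γ' * t

theorem Normalizes.mul {E : Type*} [Monoid E] {G : Submonoid E} {s t : E} (hs : Normalizes G s)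
    (ht : Normalizes G t) : Normalizes G (s * t) := by
  intro γ hγ
  obtain ⟨γ', hγ', h⟩ := ht γ hγ
  obtain ⟨γ'', hγ'', h'⟩ := hs γ' hγ'
  exact ⟨γ'', hγ'', by rw [mul_assoc, h, ← mul_assoc, h', mul_assoc]⟩

theorem NearlyAbelian.exists_commutator (hna : NearlyAbelian S) {f g : Function.End ℂ}
    (hf : f ∈ S) (hg : g ∈ S) : ∃ γ ∈ naCommutatorSet S, f * g = γ * (g * f) := by
  obtain ⟨γ, hγ, h⟩ := hna.2 f hf g hg
  exact ⟨γ, ⟨hγ, f, hf, g, hg, h⟩, h⟩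

theorem NearlyAbelian.normalizes (hna : NearlyAbelian S) {h : Function.End ℂ} (hh : h ∈ S) :
    Normalizes (naCommutatorGroup S) h := by
  have hK : ∀ γ ∈ naCommutatorSet S, ∃ γ' ∈ naCommutatorGroup S, h * γ = γ' * h := by
    rintro γ ⟨hγ, f, hf, g, hg, hfg⟩
    obtain ⟨γ₁, hγ₁, h₁⟩ := hna.exists_commutator hh (mul_mem hf hg)
    obtain ⟨γ₂, hγ₂, h₂⟩ := hna.exists_commutator (mul_mem hg hf) hh
    have hmem : γ₁ * γ * γ₂ ∈ naCommutatorGroup S :=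
      mul_mem (mul_mem (Submonoid.subset_closure (Or.inl hγ₁))
        (Submonoid.subset_closure (Or.inl ⟨hγ, f, hf, g, hg, hfg⟩)))
        (Submonoid.subset_closure (Or.inl hγ₂))
    have hgf := hna.1 _ (mul_mem hg hf)
    have hhd := (hna.1 h hh).1
    refine ⟨_, hmem, entire_right_cancel (hhd.comp hγ.differentiable)
      ((isAffine_of_mem_naCommutatorGroup hmem).differentiable.comp hhd) hgf.1 hgf.2 ?_⟩
    calc h * γ * (g * f) = h * (f * g) := by rw [hfg, mul_assoc]
      _ = γ₁ * (γ * (g * f) * h) := by rw [h₁, hfg]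
      _ = γ₁ * (γ * (γ₂ * (h * (g * f)))) := by rw [mul_assoc γ, h₂]
      _ = γ₁ * γ * γ₂ * h * (g * f) := by simp only [mul_assoc]
  intro γ hγ
  induction hγ using Submonoid.closure_induction with
  | mem γ hγ =>
    obtain hγ | ⟨δ, hδ, h₁, h₂⟩ := hγ
    · exact hK γ hγ
    · obtain ⟨δ', hδ', hδh⟩ := hK δ hδ
      obtain ⟨ε, hε, hεδ, -⟩ := exists_inverse_mem_naCommutatorGroup hδ'
      refine ⟨ε, hε, ?_⟩
      calc h * γ = ε * δ' * (h * γ) := by rw [hεδ, one_mul]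
        _ = ε * (δ' * h * γ) := by simp only [mul_assoc]
        _ = ε * h := by rw [← hδh, mul_assoc h, h₂, mul_one]
  | one => exact ⟨1, one_mem _, by rw [mul_one, one_mul]⟩
  | mul γ₁ γ₂ _ _ h₁ h₂ =>
    obtain ⟨δ₁, hδ₁, h₁⟩ := h₁
    obtain ⟨δ₂, hδ₂, h₂⟩ := h₂
    exact ⟨δ₁ * δ₂, mul_mem hδ₁ hδ₂, by rw [← mul_assoc, h₁, mul_assoc, h₂, mul_assoc]⟩

theorem naCommutatorGroup_le_TSemigroup {γ : Function.End ℂ} (hγ : γ ∈ naCommutatorGroup S) :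
    γ ∈ TSemigroup S := Subsemigroup.subset_closure (Or.inr hγ)

theorem NearlyAbelian.normalizes_TSemigroup (hna : NearlyAbelian S) {t : Function.End ℂ}
    (ht : t ∈ TSemigroup S) : Normalizes (naCommutatorGroup S) t := by
  induction ht using Subsemigroup.closure_induction with
  | mem t ht =>
    obtain ht | ht := ht
    · exact hna.normalizes ht
    · intro γ hγ
      obtain ⟨δ, hδ, h, -⟩ := exists_inverse_mem_naCommutatorGroup ht
      exact ⟨t * γ * δ, mul_mem (mul_mem ht hγ) hδ, by rw [mul_assoc _ δ, h, mul_one]⟩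
  | mul _ _ _ _ hs ht => exact hs.mul ht

theorem NearlyAbelian.exists_commutator_TSemigroup (hna : NearlyAbelian S)
    {s t : Function.End ℂ} (hs : s ∈ TSemigroup S) (ht : t ∈ TSemigroup S) :
    ∃ γ ∈ naCommutatorGroup S, s * t = γ * (t * s) := by
  have hswap : ∀ {a b : Function.End ℂ}, (∃ γ ∈ naCommutatorGroup S, a * b = γ * (b * a)) →
      ∃ γ ∈ naCommutatorGroup S, b * a = γ * (a * b) := by
    rintro a b ⟨γ, hγ, h⟩
    obtain ⟨δ, hδ, hδγ, -⟩ := exists_inverse_mem_naCommutatorGroup hγ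
    exact ⟨δ, hδ, by rw [h, ← mul_assoc δ, hδγ, one_mul]⟩
  have hG : ∀ {a g : Function.End ℂ}, a ∈ TSemigroup S → g ∈ naCommutatorGroup S →
      ∃ γ ∈ naCommutatorGroup S, a * g = γ * (g * a) := by
    intro a g ha hg
    obtain ⟨g', hg', h⟩ := hna.normalizes_TSemigroup ha g hg
    obtain ⟨δ, hδ, hδg, -⟩ := exists_inverse_mem_naCommutatorGroup hg
    exact ⟨g' * δ, mul_mem hg' hδ, by rw [h, mul_assoc g', ← mul_assoc δ, hδg, one_mul]⟩
  have hmul : ∀ {a b c : Function.End ℂ}, a ∈ TSemigroup S →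
      (∃ γ ∈ naCommutatorGroup S, a * c = γ * (c * a)) →
      (∃ γ ∈ naCommutatorGroup S, b * c = γ * (c * b)) →
      ∃ γ ∈ naCommutatorGroup S, a * b * c = γ * (c * (a * b)) := by
    rintro a b c ha ⟨γ, hγ, h⟩ ⟨δ, hδ, h'⟩
    obtain ⟨δ', hδ', h''⟩ := hna.normalizes_TSemigroup ha δ hδ
    refine ⟨δ' * γ, mul_mem hδ' hγ, ?_⟩
    calc a * b * c = a * δ * (c * b) := by rw [mul_assoc, h', mul_assoc]
      _ = δ' * (a * c) * b := by rw [h'']; simp only [mul_assoc]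
      _ = δ' * γ * (c * (a * b)) := by rw [h]; simp only [mul_assoc]
  induction hs, ht using Subsemigroup.closure_induction₂ with
  | mem s t hs ht =>
    obtain ht | ht := ht
    · obtain hs | hs := hs
      · obtain ⟨γ, hγ, h⟩ := hna.exists_commutator hs ht
        exact ⟨γ, Submonoid.subset_closure (Or.inl hγ), h⟩
      · exact hswap (hG (Subsemigroup.subset_closure (Or.inl ht)) hs)
    · exact hG (Subsemigroup.subset_closure hs) ht
  | mul_left _ _ _ hx _ _ h₁ h₂ => exact hmul hx h₁ h₂
  | mul_right _ _ _ hx _ _ h₁ h₂ => exact hswap (hmul hx (hswap h₁) (hswap h₂))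

variable (S) in
/-- The translations in the commutator group. -/
def naTranslations : Submonoid (Function.End ℂ) where
  carrier := {γ | γ ∈ naCommutatorGroup S ∧ ∃ b : ℂ, ∀ z, γ z = z + b}
  one_mem' := ⟨one_mem _, 0, fun z => (add_zero z).symm⟩
  mul_mem' := by
    rintro γ δ ⟨hγ, b, hb⟩ ⟨hδ, c, hc⟩
    refine ⟨mul_mem hγ hδ, c + b, fun z => ?_⟩
    change γ (δ z) = _
    rw [hc, hb, add_assoc]

theorem exists_translation_commutator {t a b : Function.End ℂ} (ht : t ∈ naCommutatorGroup S)
    (ha : a ∈ naCommutatorGroup S) (hb : b ∈ naCommutatorGroup S) :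
    ∃ n ∈ naTranslations S, t * (a * b) = n * (t * (b * a)) := by
  have hx := mul_mem ht (mul_mem ha hb)
  obtain ⟨y, hy, hyl, hyr⟩ := exists_inverse_mem_naCommutatorGroup (mul_mem ht (mul_mem hb ha))
  have hxy : t * (a * b) = t * (a * b) * y * (t * (b * a)) := by rw [mul_assoc _ y, hyl, mul_one]
  refine ⟨_, ⟨mul_mem hx hy, ?_⟩, hxy⟩
  obtain ⟨t₁, t₀, ht₁, ht⟩ := isAffine_of_mem_naCommutatorGroup ht
  obtain ⟨a₁, a₀, ha₁, ha⟩ := isAffine_of_mem_naCommutatorGroup ha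
  obtain ⟨b₁, b₀, hb₁, hb⟩ := isAffine_of_mem_naCommutatorGroup hb
  refine ⟨t₁ * (a₁ * b₀ + a₀) - t₁ * (b₁ * a₀ + b₀), fun z => ?_⟩
  have hz : t (b (a (y z))) = z := congrFun hyr z
  change t (a (b (y z))) = _
  rw [ha, hb, ht] at hz
  rw [hb, ha, ht]
  linear_combination hz

variable (S)

theorem naTranslations_hasRightInvariantMean [TopologicalSpace (naTranslations S)]
    [DiscreteTopology (naTranslations S)] : HasRightInvariantMean (naTranslations S) := by
  refine (hasRightInvariantMean_of_unique Unit).of_comm_mod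
    ⟨fun _ => 1, fun _ _ => (one_mul _).symm⟩ fun t a b => ⟨1, ?_⟩
  obtain ⟨-, c, hc⟩ := a.2
  obtain ⟨-, d, hd⟩ := b.2
  have hab : a * b = b * a := by
    refine Subtype.ext (funext fun z => ?_)
    change a.1 (b.1 z) = b.1 (a.1 z)
    rw [hc, hd, hd, hc]
    ring
  rw [hab]
  exact (one_mul _).symm

theorem naCommutatorGroup_hasRightInvariantMean [TopologicalSpace (naCommutatorGroup S)]
    [DiscreteTopology (naCommutatorGroup S)] : HasRightInvariantMean (naCommutatorGroup S) := by
  let : TopologicalSpace (naTranslations S) := ⊥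
  have : DiscreteTopology (naTranslations S) := ⟨rfl⟩
  refine (naTranslations_hasRightInvariantMean S).of_comm_mod
    ⟨fun n => ⟨n.1, n.2.1⟩, fun _ _ => rfl⟩ fun t a b => ?_
  obtain ⟨n, hn, h⟩ := exists_translation_commutator t.2 a.2 b.2
  exact ⟨⟨n, hn⟩, Subtype.ext h⟩

end CommutatorGroup

/-- For a nearly abelian semigroup `S` of non-constant entire maps, the
semigroup `T(S)` generated by `S` together with the group `G(S)` generated by the
commutator set `K(S)` is right amenable. -/
theorem nearly_abelian_TS_right_amenable (S : Subsemigroup (Function.End ℂ))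
    (hna : NearlyAbelian S) :
    RightAmenable (TSemigroup S) := by
  let : TopologicalSpace (naCommutatorGroup S) := ⊥
  have : DiscreteTopology (naCommutatorGroup S) := ⟨rfl⟩
  let : TopologicalSpace (TSemigroup S) := ⊥
  have : DiscreteTopology (TSemigroup S) := ⟨rfl⟩
  have : Nonempty (TSemigroup S) := ⟨⟨1, naCommutatorGroup_le_TSemigroup (one_mem _)⟩⟩
  refine ((naCommutatorGroup_hasRightInvariantMean S).of_comm_mod
    ⟨fun γ => (⟨γ.1, naCommutatorGroup_le_TSemigroup γ.2⟩ : TSemigroup S), fun _ _ => rfl⟩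
    fun t a b => ?_).rightAmenable
  obtain ⟨γ, hγ, h⟩ := hna.exists_commutator_TSemigroup a.2 b.2
  obtain ⟨γ', hγ', h'⟩ := hna.normalizes_TSemigroup t.2 γ hγ
  refine ⟨⟨γ', hγ'⟩, Subtype.ext ?_⟩
  change t.1 * (a.1 * b.1) = γ' * (t.1 * (b.1 * a.1))
  rw [h, ← mul_assoc, h', mul_assoc]

end
end

section
/- Let S ⊆ 𝔖₂ be a semigroup of nonzero formal series under substitution (every element of S has zero constant coefficient and zero linear coefficient). Then at least one of the following holds: (i) S contains a non-cyclic free subsemigroup; (ii) S contains a non-cyclic free abelian subsemigroup; (iii) for every pair f, g ∈ S there exist integers k, l ≥ 1 such that f^k∘g^l = f^{2k} and g^l∘f^k = g^{2l}, where powers denote iterates under substitution. -/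
open Function

noncomputable section

/-- `a` and `b` generate a free subsemigroup on two generators: the semigroup homomorphism
from the free semigroup on two generators sending the generators to `a` and `b` is
injective, i.e. distinct nonempty words in `a`, `b` give distinct elements. -/
def IsFreePair {M : Type*} [Semigroup M] (a b : M) : Prop :=
  Function.Injective
    ((FreeSemigroup.lift (fun x : Bool => if x then a else b) : FreeSemigroup Bool →ₙ* M) :
      FreeSemigroup Bool → M)

/-- The set `S` (closed under the operation) contains a non-cyclic free subsemigroup. -/
def ContainsFreeSubsemigroup {M : Type*} [Semigroup M] (S : Set M) : Prop :=
  ∃ a ∈ S, ∃ b ∈ S, IsFreePair a b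

/-- The set `S` contains a non-cyclic free abelian subsemigroup : there are commuting
`a, b ∈ S` such that the elements `a ^ m * b ^ n`, for `(m, n) ≠ (0, 0)`, are pairwise
distinct. -/
def ContainsFreeAbelianSubsemigroup {M : Type*} [Monoid M] (S : Set M) : Prop :=
  ∃ a ∈ S, ∃ b ∈ S, a * b = b * a ∧
    ∀ m n p q : ℕ, (m, n) ≠ (0, 0) → (p, q) ≠ (0, 0) →
      a ^ m * b ^ n = a ^ p * b ^ q → (m, n) = (p, q)

/-- The semigroup `𝔖` of formal power series `a₁ z + a₂ z² + ⋯` over `ℂ` with zero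
constant term, modelled as formal multilinear series from `ℂ` to `ℂ` whose `0`-th
coefficient vanishes.  Multiplication is substitution (composition) of formal series, and
the unit is the series `z`. -/
abbrev FormalS : Type := {p : FormalMultilinearSeries ℂ ℂ ℂ // p.coeff 0 = 0}

instance : Monoid FormalS where
  one := ⟨FormalMultilinearSeries.id ℂ ℂ 0, by
    rw [FormalMultilinearSeries.coeff, FormalMultilinearSeries.id_apply_zero]⟩
  mul f g := ⟨f.1.comp g.1, by
    have h0 : (f.1.comp g.1) 0 = f.1 0 := FormalMultilinearSeries.comp_coeff_zero'' _ _
    have h1 : f.1 0 = 0 := FormalMultilinearSeries.coeff_eq_zero.mp f.2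
    rw [FormalMultilinearSeries.coeff, h0, h1]
    rfl⟩
  mul_assoc f g h := Subtype.ext (FormalMultilinearSeries.comp_assoc f.1 g.1 h.1)
  one_mul f := Subtype.ext (FormalMultilinearSeries.id_comp' f.1 0 (fun i => i.elim0)
    (by rw [FormalMultilinearSeries.coeff_eq_zero.mp f.2]; rfl))
  mul_one f := Subtype.ext (f.1.comp_id 0)

/-- The coefficient `aₙ` of an element of `𝔖`. -/
def coeffS (f : FormalS) (n : ℕ) : ℂ := f.1.coeff n

open PowerSeries

/-- An element of `𝔖` as a Mathlib power series. -/
def toPowerSeries (f : FormalS) : ℂ⟦X⟧ := PowerSeries.mk (coeffS f)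

lemma coeff_toPowerSeries (f : FormalS) (n : ℕ) :
    coeff n (toPowerSeries f) = coeffS f n := coeff_mk _ _

lemma toPowerSeries_injective : Injective toPowerSeries := by
  intro f g h
  refine Subtype.ext (funext fun n => ?_)
  have hn : f.1.coeff n = g.1.coeff n := by
    simpa only [coeff_toPowerSeries, coeffS] using congrArg (coeff n) h
  exact (f.1.mkPiRing_coeff_eq n).symm.trans
    ((congrArg _ hn).trans (g.1.mkPiRing_coeff_eq n))

lemma constantCoeff_toPowerSeries (f : FormalS) : constantCoeff (toPowerSeries f) = 0 := by
  rw [← coeff_zero_eq_constantCoeff_apply, coeff_toPowerSeries, coeffS, f.2]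

lemma toPowerSeries_ne_zero {f : FormalS} (hf : f.1 ≠ 0) : toPowerSeries f ≠ 0 := by
  contrapose hf
  refine funext fun n => FormalMultilinearSeries.coeff_eq_zero.mp ?_
  simpa [coeff_toPowerSeries, coeffS] using congrArg (coeff n) hf

lemma toPowerSeries_one : toPowerSeries 1 = X := by
  ext n
  rw [coeff_toPowerSeries, coeffS, coeff_X]
  change (FormalMultilinearSeries.id ℂ ℂ 0).coeff n = _
  obtain _ | _ | n := n
  · exact FormalMultilinearSeries.id_apply_zero ℂ ℂ 0 1
  · exact FormalMultilinearSeries.id_apply_one ℂ ℂ 0 1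
  · simp [FormalMultilinearSeries.coeff, FormalMultilinearSeries.id_apply_of_one_lt]

lemma coeffS_mul (f g : FormalS) (n : ℕ) :
    coeffS (f * g) n =
      ∑ c : Composition n, coeffS f c.length * ∏ i, coeffS g (c.blocksFun i) := by
  change (f.1.comp g.1).coeff n = _
  rw [FormalMultilinearSeries.coeff, FormalMultilinearSeries.comp,
    sum_apply]
  refine Finset.sum_congr rfl fun c _ => ?_
  rw [FormalMultilinearSeries.compAlongComposition_apply,
    FormalMultilinearSeries.apply_eq_prod_smul_coeff, smul_eq_mul, mul_comm, coeffS]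
  refine congrArg _ (Finset.prod_congr rfl fun i _ => ?_)
  rw [FormalMultilinearSeries.applyComposition, FormalMultilinearSeries.apply_eq_prod_smul_coeff]
  simp [coeffS]

lemma coeff_pow_eq_sum_piAntidiag (φ : ℂ⟦X⟧) (d n : ℕ) :
    coeff n (φ ^ d) = ∑ l ∈ Finset.piAntidiag (Finset.univ : Finset (Fin d)) n,
      ∏ i, coeff (l i) φ := by
  have h := PowerSeries.coeff_prod (fun _ : Fin d => φ) n Finset.univ
  rw [Finset.prod_const, Finset.card_univ, Fintype.card_fin] at h
  rw [h]
  refine Finset.sum_bij (fun l _ => ⇑l) ?_ ?_ ?_ ?_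
  · intro l hl
    simpa using hl
  · intro l _ m _ hlm
    exact DFunLike.coe_injective hlm
  · intro l hl
    exact ⟨Finsupp.equivFunOnFinite.symm l, by simpa using hl, by simp⟩
  · intro l _
    rfl

lemma coeff_subst_eq_sum (φ ψ : ℂ⟦X⟧) (hψ : constantCoeff ψ = 0) (n : ℕ) :
    coeff n (φ.subst ψ) = ∑ d ∈ Finset.range (n + 1), coeff d φ * coeff n (ψ ^ d) := by
  rw [coeff_subst' (HasSubst.of_constantCoeff_zero' hψ)]
  refine finsum_eq_sum_of_support_subset _ fun d hd => ?_
  by_contra hdn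
  refine hd ?_
  have hX : X ^ d ∣ ψ ^ d := pow_dvd_pow_of_dvd (X_dvd_iff.mpr hψ) d
  have hn : n < d := by simpa using hdn
  simp [X_pow_dvd_iff.mp hX n hn]

lemma toPowerSeries_mul (f g : FormalS) :
    toPowerSeries (f * g) = (toPowerSeries f).subst (toPowerSeries g) := by
  ext n
  rw [coeff_toPowerSeries, coeffS_mul, coeff_subst_eq_sum _ _ (constantCoeff_toPowerSeries g)]
  simp_rw [coeff_pow_eq_sum_piAntidiag, Finset.mul_sum]
  rw [Finset.sum_sigma']
  refine Finset.sum_of_injOn (fun c => ⟨c.length, c.blocksFun⟩) ?_ ?_ ?_ ?_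
  · intro c _ c' _ h
    ext1
    rw [← c.ofFn_blocksFun, ← c'.ofFn_blocksFun]
    exact List.ofFn_inj'.mpr h
  · intro c _
    simp [c.length_le, c.sum_blocksFun]
  · rintro ⟨d, l⟩ hl hnot
    by_cases hpos : ∀ i, 0 < l i
    · refine absurd ⟨⟨List.ofFn l, ?_, ?_⟩, by simp, ?_⟩ hnot
      · intro i hi
        obtain ⟨j, rfl⟩ := (List.mem_ofFn' l _).mp hi
        exact hpos j
      · have := (Finset.mem_piAntidiag.mp (Finset.mem_sigma.mp hl).2).1
        simpa [List.sum_ofFn] using this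
      · exact List.ofFn_inj'.mp (Composition.ofFn_blocksFun _)
    · push Not at hpos
      obtain ⟨i, hi⟩ := hpos
      have h0 : coeff (l i) (toPowerSeries g) = 0 := by
        rw [Nat.le_zero.mp hi, coeff_zero_eq_constantCoeff_apply, constantCoeff_toPowerSeries]
      simp only []
      rw [Finset.prod_eq_zero (Finset.mem_univ i) h0, mul_zero]
  · intro c _
    simp [coeff_toPowerSeries]

/-- The order of vanishing at `0` of a power series, as a natural number. -/
def natOrder (u : ℂ⟦X⟧) : ℕ := u.order.toNat

/-- The logarithmic derivative `z u' / u` of a nonzero power series `u`. -/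
def eulerLog (u : ℂ⟦X⟧) : ℂ⟦X⟧ :=
  C (natOrder u : ℂ) + X * d⁄dX ℂ (divXPowOrder u) * (divXPowOrder u)⁻¹

lemma constantCoeff_eulerLog (u : ℂ⟦X⟧) : constantCoeff (eulerLog u) = natOrder u := by
  simp [eulerLog]

lemma constantCoeff_divXPowOrder_ne_zero {u : ℂ⟦X⟧} (hu : u ≠ 0) :
    constantCoeff (divXPowOrder u) ≠ 0 :=
  fun h => hu (constantCoeff_divXPowOrder_eq_zero_iff.mp h)

lemma X_mul_derivative_eq {u : ℂ⟦X⟧} (hu : u ≠ 0) : X * d⁄dX ℂ u = u * eulerLog u := by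
  have hinv := PowerSeries.mul_inv_cancel _ (constantCoeff_divXPowOrder_ne_zero hu)
  have hX : X * d⁄dX ℂ (X ^ natOrder u : ℂ⟦X⟧) = C (natOrder u : ℂ) * X ^ natOrder u := by
    generalize natOrder u = m
    obtain _ | m := m
    · simp
    · rw [Derivation.leibniz_pow]
      simp [pow_succ]
      ring
  have hu0 : u = X ^ natOrder u * divXPowOrder u := X_pow_order_mul_divXPowOrder.symm
  have key : X * d⁄dX ℂ (X ^ natOrder u * divXPowOrder u) =
      X ^ natOrder u * divXPowOrder u * eulerLog u := by
    rw [Derivation.leibniz, eulerLog, smul_eq_mul, smul_eq_mul]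
    linear_combination divXPowOrder u * hX -
      X * d⁄dX ℂ (divXPowOrder u) * X ^ natOrder u * hinv
  rwa [← hu0] at key

lemma eq_eulerLog {u p : ℂ⟦X⟧} (hu : u ≠ 0) (h : X * d⁄dX ℂ u = u * p) : p = eulerLog u :=
  mul_left_cancel₀ hu (h.symm.trans (X_mul_derivative_eq hu))

lemma constantCoeff_subst_eq (p : ℂ⟦X⟧) {v : ℂ⟦X⟧} (hv : constantCoeff v = 0) :
    constantCoeff (p.subst v) = constantCoeff p := by
  rw [← coeff_zero_eq_constantCoeff_apply, coeff_subst_eq_sum _ _ hv]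
  simp

lemma subst_ne_zero {u v : ℂ⟦X⟧} (hu : u ≠ 0) (hv : v ≠ 0) (hv0 : constantCoeff v = 0) :
    u.subst v ≠ 0 := by
  have hs := HasSubst.of_constantCoeff_zero' hv0
  rw [← X_pow_order_mul_divXPowOrder (f := u), subst_mul hs, subst_pow hs, subst_X hs]
  refine mul_ne_zero (pow_ne_zero _ hv) fun h => ?_
  have := constantCoeff_subst_eq (divXPowOrder u) hv0
  rw [h, map_zero] at this
  exact constantCoeff_divXPowOrder_ne_zero hu this.symm

lemma subst_right_cancel {u u' v : ℂ⟦X⟧} (hv : v ≠ 0) (hv0 : constantCoeff v = 0)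
    (h : u.subst v = u'.subst v) : u = u' := by
  by_contra hne
  refine subst_ne_zero (sub_ne_zero.mpr hne) hv hv0 ?_
  rw [subst_sub (HasSubst.of_constantCoeff_zero' hv0), h, sub_self]

lemma eulerLog_subst {u v : ℂ⟦X⟧} (hu : u ≠ 0) (hv : v ≠ 0) (hv0 : constantCoeff v = 0) :
    eulerLog (u.subst v) = eulerLog v * (eulerLog u).subst v := by
  have hs := HasSubst.of_constantCoeff_zero' hv0
  symm
  refine eq_eulerLog (subst_ne_zero hu hv hv0) ?_
  have h := congrArg (PowerSeries.subst v) (X_mul_derivative_eq hu)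
  rw [subst_mul hs, subst_mul hs, subst_X hs] at h
  rw [derivative_subst hs]
  linear_combination (d⁄dX ℂ u).subst v * X_mul_derivative_eq hv + eulerLog v * h

lemma natOrder_subst {u v : ℂ⟦X⟧} (hu : u ≠ 0) (hv : v ≠ 0) (hv0 : constantCoeff v = 0) :
    natOrder (u.subst v) = natOrder u * natOrder v := by
  have h := congrArg constantCoeff (eulerLog_subst hu hv hv0)
  rw [map_mul, constantCoeff_subst_eq _ hv0, constantCoeff_eulerLog, constantCoeff_eulerLog,
    constantCoeff_eulerLog] at h
  rw [mul_comm]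
  exact_mod_cast h

lemma eulerLog_pow {u : ℂ⟦X⟧} (hu : u ≠ 0) (n : ℕ) :
    eulerLog (u ^ n) = C (n : ℂ) * eulerLog u := by
  symm
  refine eq_eulerLog (pow_ne_zero n hu) ?_
  obtain _ | n := n
  · simp
  · rw [Derivation.leibniz_pow]
    simp only [Nat.add_sub_cancel, smul_eq_mul, nsmul_eq_mul, map_natCast]
    linear_combination ((n + 1 : ℕ) : ℂ⟦X⟧) * u ^ n * X_mul_derivative_eq hu

lemma eulerLog_X : eulerLog (X : ℂ⟦X⟧) = 1 :=
  (eq_eulerLog X_ne_zero (by simp)).symm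

lemma natOrder_eq_of_eulerLog_eq {u v : ℂ⟦X⟧} (h : eulerLog u = eulerLog v) :
    natOrder u = natOrder v := by
  have := congrArg constantCoeff h
  rw [constantCoeff_eulerLog, constantCoeff_eulerLog] at this
  exact_mod_cast this

lemma natOrder_pow {u : ℂ⟦X⟧} (hu : u ≠ 0) (n : ℕ) : natOrder (u ^ n) = n * natOrder u := by
  have h := congrArg constantCoeff (eulerLog_pow hu n)
  rw [map_mul, constantCoeff_eulerLog, constantCoeff_eulerLog] at h
  simpa [← Nat.cast_mul] using h

lemma coeff_natOrder_ne_zero {u : ℂ⟦X⟧} (hu : u ≠ 0) : coeff (natOrder u) u ≠ 0 :=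
  coeff_order hu

lemma exists_eq_C_mul_of_eulerLog_eq {u v : ℂ⟦X⟧} (hu : u ≠ 0) (hv : v ≠ 0)
    (h : eulerLog u = eulerLog v) : ∃ c : ℂ, c ≠ 0 ∧ u = C c * v := by
  have hord := natOrder_eq_of_eulerLog_eq h
  have hcv := coeff_natOrder_ne_zero hv
  have hcu := coeff_natOrder_ne_zero hu
  rw [hord] at hcu
  refine ⟨coeff (natOrder v) u / coeff (natOrder v) v, div_ne_zero hcu hcv, ?_⟩
  set c := coeff (natOrder v) u / coeff (natOrder v) v with hc
  by_contra hne
  have hw : u - C c * v ≠ 0 := sub_ne_zero.mpr hne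
  have hX : X * d⁄dX ℂ (u - C c * v) = (u - C c * v) * eulerLog v := by
    have h1 := X_mul_derivative_eq hu
    have h2 := X_mul_derivative_eq hv
    rw [h] at h1
    rw [map_sub, Derivation.leibniz, derivative_C]
    simp only [smul_eq_mul, mul_zero, add_zero]
    linear_combination h1 - C c * h2
  have hwo := natOrder_eq_of_eulerLog_eq (eq_eulerLog hw hX)
  refine coeff_natOrder_ne_zero hw ?_
  rw [← hwo, map_sub, coeff_C_mul, hc, div_mul_cancel₀ _ hcv, sub_self]

lemma exists_eulerLog_eq {p : ℂ⟦X⟧} (hp : constantCoeff p = 1) :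
    ∃ u : ℂ⟦X⟧, u ≠ 0 ∧ eulerLog u = p := by
  let q : ℂ⟦X⟧ := PowerSeries.mk fun n => coeff n p / n
  have hq : X * d⁄dX ℂ q = p - 1 := by
    ext n
    obtain _ | n := n
    · simp [hp]
    · have : ((n : ℂ) + 1) ≠ 0 := by exact_mod_cast n.succ_ne_zero
      rw [coeff_succ_X_mul, coeff_derivative, map_sub, coeff_mk, coeff_one]
      push_cast
      simp [this]
  have hs : HasSubst q := HasSubst.of_constantCoeff_zero' (by
    rw [← coeff_zero_eq_constantCoeff_apply, coeff_mk]; simp)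
  have hq0 : constantCoeff q = 0 := by
    rw [← coeff_zero_eq_constantCoeff_apply, coeff_mk]; simp
  have hne : X * (exp ℂ).subst q ≠ 0 := by
    refine mul_ne_zero X_ne_zero fun h => ?_
    have := constantCoeff_subst_eq (exp ℂ) hq0
    rw [h] at this
    simp at this
  refine ⟨_, hne, (eq_eulerLog hne ?_).symm⟩
  rw [Derivation.leibniz, derivative_subst hs, derivative_exp, derivative_X]
  simp only [smul_eq_mul]
  linear_combination X * (exp ℂ).subst q * hq

/-- The order of vanishing of an element of `𝔖`. -/
def orderS (f : FormalS) : ℕ := natOrder (toPowerSeries f)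

/-- The submonoid of nonzero elements of `𝔖`. -/
def nonzeroS : Submonoid FormalS where
  carrier := {f | toPowerSeries f ≠ 0}
  one_mem' := by simp [toPowerSeries_one, X_ne_zero]
  mul_mem' {f g} hf hg := by
    rw [Set.mem_ofPred_eq, toPowerSeries_mul]
    exact subst_ne_zero hf hg (constantCoeff_toPowerSeries g)

lemma orderS_mul {f g : FormalS} (hf : f ∈ nonzeroS) (hg : g ∈ nonzeroS) :
    orderS (f * g) = orderS f * orderS g := by
  rw [orderS, toPowerSeries_mul, natOrder_subst hf hg (constantCoeff_toPowerSeries g)]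
  rfl

lemma orderS_one : orderS 1 = 1 := by
  simp [orderS, toPowerSeries_one, natOrder]

lemma orderS_pow {f : FormalS} (hf : f ∈ nonzeroS) (k : ℕ) : orderS (f ^ k) = orderS f ^ k := by
  induction k with
  | zero => simp [orderS_one]
  | succ k ih => rw [pow_succ, orderS_mul (pow_mem hf k) hf, ih, pow_succ]

lemma orderS_pos {f : FormalS} (hf : f ∈ nonzeroS) : 0 < orderS f := by
  refine Nat.pos_of_ne_zero fun h => coeff_natOrder_ne_zero hf ?_
  rw [← orderS, h, coeff_zero_eq_constantCoeff_apply, constantCoeff_toPowerSeries]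

lemma two_le_orderS {f : FormalS} (hf : f ∈ nonzeroS) (h1 : coeffS f 1 = 0) : 2 ≤ orderS f := by
  have h0 := orderS_pos hf
  have : orderS f ≠ 1 := fun h => coeff_natOrder_ne_zero hf (by
    rw [← orderS, h, coeff_toPowerSeries, h1])
  omega

lemma mul_right_cancel_of_mem_nonzeroS {f g h : FormalS} (hh : h ∈ nonzeroS)
    (e : f * h = g * h) : f = g := by
  apply toPowerSeries_injective
  apply subst_right_cancel hh (constantCoeff_toPowerSeries h)
  rw [← toPowerSeries_mul, ← toPowerSeries_mul, e]

/-- The logarithmic derivative `z f' / f`, normalised to have constant term `1`. -/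
def normLog (f : FormalS) : ℂ⟦X⟧ := C (orderS f : ℂ)⁻¹ * eulerLog (toPowerSeries f)

lemma normLog_one : normLog 1 = 1 := by
  simp [normLog, orderS_one, toPowerSeries_one, eulerLog_X]

lemma C_orderS_mul_normLog {f : FormalS} (hf : f ∈ nonzeroS) :
    C (orderS f : ℂ) * normLog f = eulerLog (toPowerSeries f) := by
  have h : (orderS f : ℂ) ≠ 0 := Nat.cast_ne_zero.mpr (orderS_pos hf).ne'
  rw [normLog, ← mul_assoc, ← map_mul, mul_inv_cancel₀ h, map_one, one_mul]

lemma constantCoeff_normLog {f : FormalS} (hf : f ∈ nonzeroS) :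
    constantCoeff (normLog f) = 1 := by
  have h : (orderS f : ℂ) ≠ 0 := Nat.cast_ne_zero.mpr (orderS_pos hf).ne'
  rw [normLog, map_mul, constantCoeff_eulerLog, constantCoeff_C]
  exact inv_mul_cancel₀ h

lemma C_subst_toPowerSeries (c : ℂ) (f : FormalS) : (C c).subst (toPowerSeries f) = C c :=
  PowerSeries.subst_C c

lemma hasSubst_toPowerSeries (f : FormalS) : HasSubst (toPowerSeries f) :=
  HasSubst.of_constantCoeff_zero' (constantCoeff_toPowerSeries f)

lemma normLog_mul {u f : FormalS} (hu : u ∈ nonzeroS) (hf : f ∈ nonzeroS) :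
    normLog (u * f) = normLog f * (normLog u).subst (toPowerSeries f) := by
  rw [normLog, orderS_mul hu hf, toPowerSeries_mul,
    eulerLog_subst hu hf (constantCoeff_toPowerSeries f), normLog, normLog,
    subst_mul (hasSubst_toPowerSeries f), C_subst_toPowerSeries, Nat.cast_mul, mul_inv, map_mul]
  ring

lemma X_pow_dvd_subst {p : ℂ⟦X⟧} {n : ℕ} (f : FormalS) (h : X ^ n ∣ p) :
    toPowerSeries f ^ n ∣ p.subst (toPowerSeries f) := by
  obtain ⟨q, rfl⟩ := h
  rw [subst_mul (hasSubst_toPowerSeries f), subst_pow (hasSubst_toPowerSeries f),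
    subst_X (hasSubst_toPowerSeries f)]
  exact dvd_mul_right _ _

lemma coeff_normLog_mul {u f : FormalS} (hu : u ∈ nonzeroS) (hf : f ∈ nonzeroS) {m : ℕ}
    (hm : m < orderS f) : coeff m (normLog (u * f)) = coeff m (normLog f) := by
  have h1 : X ^ 1 ∣ normLog u - 1 := by
    rw [pow_one, X_dvd_iff, map_sub, constantCoeff_normLog hu, map_one, sub_self]
  have h2 := X_pow_dvd_subst f h1
  have h3 : (1 : ℂ⟦X⟧).subst (toPowerSeries f) = 1 := by
    rw [← map_one (C (R := ℂ)), C_subst_toPowerSeries]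
  rw [pow_one, subst_sub (hasSubst_toPowerSeries f), h3] at h2
  have h4 : X ^ orderS f ∣ normLog (u * f) - normLog f := by
    rw [normLog_mul hu hf, ← mul_sub_one]
    exact dvd_mul_of_dvd_right ((X_pow_order_dvd).trans h2) _
  rw [← sub_eq_zero, ← map_sub]
  exact X_pow_dvd_iff.mp h4 m hm

/-- The limit of the normalised logarithmic derivatives of the iterates of `f`. -/
def limLog (f : FormalS) : ℂ⟦X⟧ := PowerSeries.mk fun m => coeff m (normLog (f ^ m))

lemma coeff_limLog {f : FormalS} (hf : f ∈ nonzeroS) (h2 : 2 ≤ orderS f) {m k : ℕ} (h : m ≤ k) :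
    coeff m (limLog f) = coeff m (normLog (f ^ k)) := by
  rw [limLog, coeff_mk, ← Nat.sub_add_cancel h, pow_add,
    coeff_normLog_mul (pow_mem hf _) (pow_mem hf _)]
  rw [orderS_pow hf]
  exact Nat.lt_pow_self h2

lemma constantCoeff_limLog (f : FormalS) : constantCoeff (limLog f) = 1 := by
  rw [← coeff_zero_eq_constantCoeff_apply, limLog, coeff_mk, pow_zero, normLog_one]
  simp

lemma limLog_eq {f : FormalS} (hf : f ∈ nonzeroS) (h2 : 2 ≤ orderS f) :
    limLog f = normLog f * (limLog f).subst (toPowerSeries f) := by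
  ext m
  have h1 : X ^ (m + 1) ∣ limLog f - normLog (f ^ m) := by
    refine X_pow_dvd_iff.mpr fun i hi => ?_
    rw [map_sub, coeff_limLog hf h2 (Nat.lt_succ_iff.mp hi), sub_self]
  have hX : X ∣ toPowerSeries f := X_dvd_iff.mpr (constantCoeff_toPowerSeries f)
  have h3 : X ^ (m + 1) ∣ normLog f * (limLog f).subst (toPowerSeries f) -
      normLog (f ^ m * f) := by
    rw [normLog_mul (pow_mem hf m) hf, ← mul_sub, ← subst_sub (hasSubst_toPowerSeries f)]
    exact dvd_mul_of_dvd_right ((pow_dvd_pow_of_dvd hX _).trans (X_pow_dvd_subst f h1)) _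
  have h4 := X_pow_dvd_iff.mp h3 m m.lt_succ_self
  rw [map_sub, sub_eq_zero] at h4
  rw [h4, ← pow_succ, coeff_limLog hf h2 m.le_succ]

lemma limLog_eq_of_common_left_multiples {f g : FormalS} (hf : f ∈ nonzeroS) (hg : g ∈ nonzeroS)
    (hf2 : 2 ≤ orderS f) (hg2 : 2 ≤ orderS g)
    (h : ∀ k : ℕ, ∃ u ∈ nonzeroS, ∃ v ∈ nonzeroS, u * f ^ k = v * g ^ k) :
    limLog f = limLog g := by
  ext m
  obtain ⟨u, hu, v, hv, huv⟩ := h m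
  rw [limLog, limLog, coeff_mk, coeff_mk, ← coeff_normLog_mul hu (pow_mem hf m), huv,
    coeff_normLog_mul hv (pow_mem hg m)]
  · rw [orderS_pow hg]
    exact Nat.lt_pow_self hg2
  · rw [orderS_pow hf]
    exact Nat.lt_pow_self hf2

/-- In the coordinate `β`, the series `f` is the monomial `c zⁿ`. -/
def IsMonomialIn (β : ℂ⟦X⟧) (f : FormalS) (c : ℂ) (n : ℕ) : Prop :=
  β.subst (toPowerSeries f) = C c * β ^ n

lemma exists_isMonomialIn_of_eulerLog_eq {β : ℂ⟦X⟧} {f : FormalS} (hβ : β ≠ 0)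
    (h : eulerLog β = limLog f) (hf : f ∈ nonzeroS) (h2 : 2 ≤ orderS f) :
    ∃ c : ℂ, c ≠ 0 ∧ IsMonomialIn β f c (orderS f) := by
  refine exists_eq_C_mul_of_eulerLog_eq (subst_ne_zero hβ hf (constantCoeff_toPowerSeries f))
    (pow_ne_zero _ hβ) ?_
  rw [eulerLog_subst hβ hf (constantCoeff_toPowerSeries f), eulerLog_pow hβ, h,
    ← C_orderS_mul_normLog hf, mul_assoc, ← limLog_eq hf h2]

lemma natOrder_eq_one_of_eulerLog_eq_limLog {β : ℂ⟦X⟧} {f : FormalS}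
    (h : eulerLog β = limLog f) : natOrder β = 1 := by
  have := congrArg constantCoeff h
  rw [constantCoeff_eulerLog, constantCoeff_limLog] at this
  exact_mod_cast this

lemma freeSemigroup_lift_eq_prod {α M : Type*} [Monoid M] (φ : α → M) (w : FreeSemigroup α) :
    FreeSemigroup.lift φ w = ((w.head :: w.tail).map φ).prod := by
  induction w using FreeSemigroup.recOnMul with
  | ih1 x => simp
  | ih2 x y hx hy =>
    rw [map_mul, hy, FreeSemigroup.lift_of]
    simp

lemma isFreePair_of_list_injective {M : Type*} [Monoid M] {a b : M}
    (h : ∀ l l' : List Bool, (l.map fun x => if x then a else b).prod =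
      (l'.map fun x => if x then a else b).prod → l = l') : IsFreePair a b := by
  intro w w' hw
  rw [freeSemigroup_lift_eq_prod, freeSemigroup_lift_eq_prod] at hw
  have := h _ _ hw
  rw [List.cons.injEq] at this
  exact FreeSemigroup.ext this.1 this.2

/-- If two elements of a submonoid `T` are right cancellable and not left invertible in `T`, and
do not generate a free semigroup, then they have a common left multiple in `T`. -/
lemma exists_common_left_multiple {M : Type*} [Monoid M] (T : Submonoid M) {a b : M}
    (ha : a ∈ T) (hb : b ∈ T) (hca : ∀ s ∈ T, ∀ t ∈ T, s * a = t * a → s = t)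
    (hcb : ∀ s ∈ T, ∀ t ∈ T, s * b = t * b → s = t)
    (h1a : ∀ t ∈ T, t * a ≠ 1) (h1b : ∀ t ∈ T, t * b ≠ 1) (hfree : ¬ IsFreePair a b) :
    ∃ s ∈ T, ∃ t ∈ T, s * a = t * b := by
  by_contra! hne
  refine hfree (isFreePair_of_list_injective fun l => ?_)
  have hT : ∀ l : List Bool, (l.map fun x => if x then a else b).prod ∈ T := by
    intro l
    refine list_prod_mem fun y hy => ?_
    obtain ⟨x, -, rfl⟩ := List.mem_map.mp hy
    cases x
    · exact hb
    · exact ha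
  induction l using List.reverseRecOn with
  | nil =>
    intro l'
    induction l' using List.reverseRecOn with
    | nil => simp
    | append_singleton l' x _ =>
      intro h
      rw [List.map_append, List.prod_append] at h
      cases x
      · exact absurd h.symm (by simpa using h1b _ (hT l'))
      · exact absurd h.symm (by simpa using h1a _ (hT l'))
  | append_singleton l x ih =>
    intro l'
    induction l' using List.reverseRecOn with
    | nil =>
      intro h
      rw [List.map_append, List.prod_append] at h
      cases x
      · exact absurd h (by simpa using h1b _ (hT l))
      · exact absurd h (by simpa using h1a _ (hT l))
    | append_singleton l' y _ =>
      intro h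
      rw [List.map_append, List.prod_append, List.map_append, List.prod_append] at h
      cases x <;> cases y <;> simp only [List.map_cons, List.map_nil, List.prod_singleton,
        if_true, Bool.false_eq_true, if_false] at h
      · rw [ih l' (hcb _ (hT l) _ (hT l') h)]
      · exact absurd h.symm (hne _ (hT l') _ (hT l))
      · exact absurd h (hne _ (hT l) _ (hT l'))
      · rw [ih l' (hca _ (hT l) _ (hT l') h)]

namespace IsMonomialIn

variable {β : ℂ⟦X⟧} {f g : FormalS} {c c' : ℂ} {n m : ℕ}

lemma one (β : ℂ⟦X⟧) : IsMonomialIn β 1 1 1 := by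
  rw [IsMonomialIn, toPowerSeries_one, X_subst, map_one, one_mul, pow_one]

lemma mul (hf : IsMonomialIn β f c n) (hg : IsMonomialIn β g c' m) :
    IsMonomialIn β (f * g) (c * c' ^ n) (n * m) := by
  unfold IsMonomialIn at *
  have hs := hasSubst_toPowerSeries g
  rw [toPowerSeries_mul, ← subst_comp_subst_apply (hasSubst_toPowerSeries f) hs, hf,
    subst_mul hs, subst_pow hs, hg, C_subst_toPowerSeries, mul_pow, ← map_pow, map_mul]
  ring

lemma pow (hf : IsMonomialIn β f c n) (k : ℕ) :
    IsMonomialIn β (f ^ k) (c ^ ∑ i ∈ Finset.range k, n ^ i) (n ^ k) := by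
  induction k with
  | zero => simpa using one β
  | succ k ih =>
    rw [pow_succ, Finset.sum_range_succ, pow_add, pow_succ n]
    exact ih.mul hf

lemma eq (h0 : constantCoeff β = 0) (h1 : coeff 1 β ≠ 0) (hf : IsMonomialIn β f c n)
    (hg : IsMonomialIn β g c n) : f = g := by
  apply toPowerSeries_injective
  have hu : IsUnit (coeff 1 β) := h1.isUnit
  have key : ∀ f : FormalS, (substInvOfIsUnit β hu).subst (β.subst (toPowerSeries f)) =
      toPowerSeries f := by
    intro f
    rw [← subst_comp_subst_apply (HasSubst.of_constantCoeff_zero' h0) (hasSubst_toPowerSeries f),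
      subst_substInvOfIsUnit_left β h0 hu, subst_X (hasSubst_toPowerSeries f)]
  rw [← key f, ← key g, hf, hg]

lemma unique (h : natOrder β = 1) (hc : c ≠ 0) (hc' : c' ≠ 0) (hf : IsMonomialIn β f c n)
    (hf' : IsMonomialIn β f c' m) : n = m ∧ c = c' := by
  have hβ : β ≠ 0 := by
    rintro rfl
    simp [natOrder] at h
  have hord : ∀ {c : ℂ} (n : ℕ), c ≠ 0 → natOrder (C c * β ^ n) = n := by
    intro c n hc
    have : (C c : ℂ⟦X⟧).order = 0 := order_zero_of_unit (hc.isUnit.map C)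
    rw [natOrder, order_mul, this, zero_add, ← natOrder, natOrder_pow hβ, h, mul_one]
  have e : C c * β ^ n = C c' * β ^ m := hf.symm.trans hf'
  obtain rfl : n = m := by rw [← hord n hc, e, hord m hc']
  exact ⟨rfl, C_injective (mul_right_cancel₀ (pow_ne_zero n hβ) e)⟩

end IsMonomialIn

/-- Two series whose iterates have common left multiples become monomials in a common
coordinate. -/
lemma exists_isMonomialIn {f g : FormalS} (hf : f ∈ nonzeroS) (hg : g ∈ nonzeroS)
    (hf2 : 2 ≤ orderS f) (hg2 : 2 ≤ orderS g)
    (h : ∀ k : ℕ, ∃ u ∈ nonzeroS, ∃ v ∈ nonzeroS, u * f ^ k = v * g ^ k) :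
    ∃ β : ℂ⟦X⟧, natOrder β = 1 ∧ IsMonomialIn β f 1 (orderS f) ∧
      ∃ c : ℂ, c ≠ 0 ∧ IsMonomialIn β g c (orderS g) := by
  obtain ⟨β, hβ, hlog⟩ := exists_eulerLog_eq (constantCoeff_limLog f)
  obtain ⟨c, hc, hfc⟩ := exists_isMonomialIn_of_eulerLog_eq hβ hlog hf hf2
  obtain ⟨γ, hγ⟩ := IsAlgClosed.exists_pow_nat_eq c (n := orderS f - 1) (by omega)
  have hγ0 : γ ≠ 0 := by
    rintro rfl
    exact hc (by rw [← hγ, zero_pow (by omega)])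
  have hβ' : C γ * β ≠ 0 := mul_ne_zero ((map_ne_zero_iff _ C_injective).mpr hγ0) hβ
  have hlog' : eulerLog (C γ * β) = limLog f := by
    refine (eq_eulerLog hβ' ?_).symm
    rw [Derivation.leibniz, derivative_C, ← hlog]
    simp only [smul_eq_mul, mul_zero, add_zero]
    linear_combination C γ * X_mul_derivative_eq hβ
  refine ⟨C γ * β, natOrder_eq_one_of_eulerLog_eq_limLog hlog', ?_,
    exists_isMonomialIn_of_eulerLog_eq hβ' (hlog'.trans
      (limLog_eq_of_common_left_multiples hf hg hf2 hg2 h)) hg hg2⟩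
  unfold IsMonomialIn at hfc ⊢
  have hγd : γ ^ orderS f = γ * c := by
    rw [← hγ, ← pow_succ', Nat.sub_add_cancel (by omega)]
  rw [subst_mul (hasSubst_toPowerSeries f), hfc, C_subst_toPowerSeries, mul_pow, ← map_pow,
    hγd, map_mul, map_one]
  ring

lemma isFreePair_of_isMonomialIn {β : ℂ⟦X⟧} {f g : FormalS} {c : ℂ} {d e : ℕ}
    (h : natOrder β = 1) (hd : 2 ≤ d) (he : 2 ≤ e)
    (hf : IsMonomialIn β f 1 d) (hg : IsMonomialIn β g c e) (hc : c ≠ 0)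
    (hfin : ¬ IsOfFinOrder c) : IsFreePair (f * g) (g * f) := by
  set digit : Bool → ℕ := fun x => if x then d else 1 with hdigit
  have hrep : ∀ l : List Bool, IsMonomialIn β
      (l.map fun x => if x then f * g else g * f).prod
      (c ^ Nat.ofDigits (d * e) (l.map digit)) ((d * e) ^ l.length) := by
    intro l
    induction l with
    | nil => simpa using IsMonomialIn.one β
    | cons x l ih =>
      have hx : IsMonomialIn β (if x then f * g else g * f) (c ^ digit x) (d * e) := by
        cases x
        · simpa [hdigit, mul_comm d] using hg.mul hf
        · simpa [hdigit] using hf.mul hg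
      rw [List.map_cons, List.prod_cons, List.map_cons, Nat.ofDigits_cons, List.length_cons,
        pow_succ', pow_add, mul_comm (d * e) (Nat.ofDigits _ _), pow_mul]
      exact hx.mul ih
  refine isFreePair_of_list_injective fun l l' hl => ?_
  have hr' := hrep l'
  rw [← hl] at hr'
  obtain ⟨hlen, hval⟩ := (hrep l).unique h (pow_ne_zero _ hc) (pow_ne_zero _ hc) hr'
  have hN : 1 < d * e := by nlinarith
  have hinj : Function.Injective fun k : ℕ => Units.mk0 c hc ^ k :=
    injective_pow_iff_not_isOfFinOrder.mpr fun h =>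
      hfin (by simpa using (Units.coeHom ℂ).isOfFinOrder h)
  have hdig : ∀ l : List Bool, ∀ x ∈ l.map digit, x < d * e := by
    intro l x hx
    obtain ⟨y, -, rfl⟩ := List.mem_map.mp hx
    cases y
    · simpa [hdigit] using hN
    · simp only [hdigit, if_true]
      nlinarith
  have hmap := Nat.ofDigits_inj_of_len_eq hN
    (by simpa using Nat.pow_right_injective hN hlen) (hdig l) (hdig l')
    (by simpa using hinj (Units.ext (by simpa using hval)))
  refine List.map_injective_iff.mpr ?_ hmap
  intro x y hxy
  cases x <;> cases y <;> simp [hdigit] at hxy ⊢ <;> omega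

lemma pow_mul_pow_injective {d e : ℕ} (hd : 2 ≤ d) (he : 2 ≤ e)
    (h : ∀ p q, 1 ≤ p → 1 ≤ q → d ^ p ≠ e ^ q) {A B n q : ℕ}
    (heq : d ^ A * e ^ n = d ^ B * e ^ q) : A = B ∧ n = q := by
  wlog hnq : n ≤ q generalizing A B n q
  · obtain ⟨h1, h2⟩ := this heq.symm (le_of_not_ge hnq)
    exact ⟨h1.symm, h2.symm⟩
  obtain ⟨r, rfl⟩ := Nat.exists_eq_add_of_le hnq
  have h1 : d ^ A = d ^ B * e ^ r := by
    refine Nat.eq_of_mul_eq_mul_right (pow_pos (by omega : 0 < e) n) ?_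
    rw [heq, pow_add]
    ring
  have hBA : d ^ B ≤ d ^ A := by
    rw [h1]
    exact Nat.le_mul_of_pos_right _ (pow_pos (by omega) r)
  obtain ⟨s, rfl⟩ := Nat.exists_eq_add_of_le ((Nat.pow_le_pow_iff_right hd).mp hBA)
  have h2 : d ^ s = e ^ r := by
    refine Nat.eq_of_mul_eq_mul_left (pow_pos (by omega : 0 < d) B) ?_
    rw [← h1, pow_add]
  obtain rfl | hs := Nat.eq_zero_or_pos s
  · have : r = 0 := by
      by_contra hr
      have := Nat.one_lt_pow hr he
      rw [← h2] at this
      simp at this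
    simp [this]
  · obtain rfl | hr := Nat.eq_zero_or_pos r
    · have := Nat.one_lt_pow hs.ne' hd
      rw [h2] at this
      simp at this
    · exact absurd h2 (h s r hs hr)

lemma exists_pow_add_eq_pow (n d : ℕ) (hn : 0 < n) :
    ∃ k j : ℕ, 0 < j ∧ (d : ZMod n) ^ (k + j) = (d : ZMod n) ^ k := by
  have : NeZero n := ⟨hn.ne'⟩
  obtain ⟨x, y, hxy, he⟩ :=
    Finite.exists_ne_map_eq_of_infinite fun k : ℕ => (d : ZMod n) ^ k
  wlog hlt : x < y generalizing x y
  · exact this y x hxy.symm he.symm (lt_of_le_of_ne (le_of_not_gt hlt) hxy.symm)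
  exact ⟨x, y - x, by omega, by rw [Nat.add_sub_cancel' hlt.le]; exact he.symm⟩

lemma exists_dvd_pow_mul_geom_sum (n D : ℕ) (hn : 0 < n) :
    ∃ K, 0 < K ∧ n ∣ (∑ i ∈ Finset.range K, D ^ i) * D ^ K := by
  obtain ⟨a, t, ht, hat⟩ := exists_pow_add_eq_pow n D hn
  set x : ZMod n := (D : ZMod n)
  have hper : ∀ N : ℕ, x ^ a * x ^ (t * N) = x ^ a := by
    intro N
    induction N with
    | zero => simp
    | succ N ih => rw [mul_add_one, pow_add, ← mul_assoc, ih, ← pow_add, hat]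
  have hsum : ∀ N : ℕ, x ^ a * ∑ i ∈ Finset.range (t * N), x ^ i =
      N * (x ^ a * ∑ i ∈ Finset.range t, x ^ i) := by
    intro N
    induction N with
    | zero => simp
    | succ N ih =>
      rw [mul_add_one, Finset.sum_range_add, mul_add, ih]
      simp_rw [pow_add, ← Finset.mul_sum]
      push_cast
      linear_combination (∑ i ∈ Finset.range t, x ^ i) * hper N
  refine ⟨t * (n * (a + 1)), by positivity, ?_⟩
  rw [← ZMod.natCast_eq_zero_iff]
  push_cast
  have hle : a ≤ t * (n * (a + 1)) := by
    have : 1 ≤ t * n := Nat.mul_pos ht hn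
    nlinarith
  obtain ⟨r, hr⟩ := Nat.exists_eq_add_of_le hle
  have h := hsum (n * (a + 1))
  rw [Nat.cast_mul, ZMod.natCast_self, zero_mul, zero_mul] at h
  calc (∑ i ∈ Finset.range (t * (n * (a + 1))), x ^ i) * x ^ (t * (n * (a + 1)))
      = (∑ i ∈ Finset.range (t * (n * (a + 1))), x ^ i) * x ^ (a + r) := by rw [← hr]
    _ = (x ^ a * ∑ i ∈ Finset.range (t * (n * (a + 1))), x ^ i) * x ^ r := by ring
    _ = 0 := by rw [h, zero_mul]

lemma Subsemigroup.pow_mem_of_pos {M : Type*} [Monoid M] (S : Subsemigroup M) {a : M}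
    (ha : a ∈ S) {k : ℕ} (hk : 0 < k) : a ^ k ∈ S := by
  induction k, hk using Nat.le_induction with
  | base => simpa using ha
  | succ k _ ih =>
    rw [pow_succ]
    exact S.mul_mem ih ha

lemma containsFreeAbelianSubsemigroup_of_isMonomialIn (S : Subsemigroup FormalS)
    {β : ℂ⟦X⟧} {f g : FormalS} {c : ℂ} {n : ℕ} (hfS : f ∈ S) (hgS : g ∈ S)
    (h0 : constantCoeff β = 0) (h1 : coeff 1 β ≠ 0)
    (hfn : f ∈ nonzeroS) (hgn : g ∈ nonzeroS) (hf2 : 2 ≤ orderS f) (hg2 : 2 ≤ orderS g)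
    (hf : IsMonomialIn β f 1 (orderS f)) (hg : IsMonomialIn β g c (orderS g))
    (hn : 0 < n) (hcn : c ^ n = 1)
    (hind : ∀ p q, 1 ≤ p → 1 ≤ q → orderS f ^ p ≠ orderS g ^ q) :
    ContainsFreeAbelianSubsemigroup (S : Set FormalS) := by
  obtain ⟨k, j, hj, hkj⟩ := exists_pow_add_eq_pow n (orderS f) hn
  have hfj : IsMonomialIn β (f ^ j) 1 (orderS f ^ j) := by simpa using hf.pow j
  have hfk : IsMonomialIn β (f ^ k) 1 (orderS f ^ k) := by simpa using hf.pow k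
  have hfkg := hfk.mul hg
  have hmem : f ^ k * g ∈ S := by
    obtain rfl | hk := Nat.eq_zero_or_pos k
    · simpa using hgS
    · exact S.mul_mem (S.pow_mem_of_pos hfS hk) hgS
  refine ⟨f ^ j, S.pow_mem_of_pos hfS hj, f ^ k * g, hmem, ?_, ?_⟩
  · have hmod : c ^ (orderS f ^ (k + j)) = c ^ (orderS f ^ k) := by
      refine pow_eq_pow_of_modEq ?_ hcn
      rw [← ZMod.natCast_eq_natCast_iff]
      exact_mod_cast hkj
    have e1 := hfj.mul hfkg
    have e2 := hfkg.mul hfj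
    rw [one_mul, one_mul, ← pow_mul, ← pow_add, hmod] at e1
    rw [one_mul, one_pow, mul_one, mul_comm _ (orderS f ^ j)] at e2
    exact e1.eq h0 h1 e2
  · intro m r p q _ _ heq
    have ho := congrArg orderS heq
    have hfk' := pow_mem hfn k
    have hfj' := pow_mem hfn j
    have hm := mul_mem hfk' hgn
    rw [orderS_mul (pow_mem hfj' m) (pow_mem hm r), orderS_mul (pow_mem hfj' p) (pow_mem hm q),
      orderS_pow hfj', orderS_pow hfj', orderS_pow hm, orderS_pow hm, orderS_mul hfk' hgn,
      orderS_pow hfn, orderS_pow hfn, mul_pow, mul_pow, ← pow_mul, ← pow_mul, ← pow_mul,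
      ← pow_mul, ← mul_assoc, ← mul_assoc, ← pow_add, ← pow_add] at ho
    obtain ⟨hA, rfl⟩ := pow_mul_pow_injective hf2 hg2 hind ho
    have : m = p := Nat.eq_of_mul_eq_mul_left hj (Nat.add_right_cancel hA)
    rw [this]

lemma exists_levin_relations {β : ℂ⟦X⟧} {f g : FormalS} {c : ℂ} {n p q D : ℕ}
    (h0 : constantCoeff β = 0) (h1 : coeff 1 β ≠ 0) (hn : 0 < n) (hcn : c ^ n = 1)
    (hp : 1 ≤ p) (hq : 1 ≤ q) (hf : IsMonomialIn β (f ^ p) 1 D)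
    (hg : IsMonomialIn β (g ^ q) c D) :
    ∃ k l : ℕ, 1 ≤ k ∧ 1 ≤ l ∧
      f ^ k * g ^ l = f ^ (2 * k) ∧ g ^ l * f ^ k = g ^ (2 * l) := by
  obtain ⟨K, hK, s, hs⟩ := exists_dvd_pow_mul_geom_sum n D hn
  have hF : IsMonomialIn β (f ^ (p * K)) 1 (D ^ K) := by
    rw [pow_mul]
    simpa using hf.pow K
  have hG : IsMonomialIn β (g ^ (q * K)) (c ^ ∑ i ∈ Finset.range K, D ^ i) (D ^ K) := by
    rw [pow_mul]
    exact hg.pow K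
  set ω := c ^ ∑ i ∈ Finset.range K, D ^ i with hω
  have hωK : ω ^ D ^ K = 1 := by rw [hω, ← pow_mul, hs, pow_mul, hcn, one_pow]
  refine ⟨p * K, q * K, Nat.mul_pos hp hK, Nat.mul_pos hq hK, ?_, ?_⟩
  · rw [two_mul, pow_add]
    have e1 := hF.mul hG
    have e2 := hF.mul hF
    rw [hωK] at e1
    rw [one_pow] at e2
    exact e1.eq h0 h1 e2
  · rw [two_mul, pow_add]
    have e1 := hG.mul hF
    have e2 := hG.mul hG
    rw [hωK] at e2
    rw [one_pow] at e1
    exact e1.eq h0 h1 e2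

lemma exists_common_left_multiple_of_not_isFreePair {f g : FormalS} (hf : f ∈ nonzeroS)
    (hg : g ∈ nonzeroS) (hf2 : 2 ≤ orderS f) (hg2 : 2 ≤ orderS g) (h : ¬ IsFreePair f g) :
    ∃ u ∈ nonzeroS, ∃ v ∈ nonzeroS, u * f = v * g := by
  have hone : ∀ {a : FormalS}, a ∈ nonzeroS → 2 ≤ orderS a → ∀ t ∈ nonzeroS, t * a ≠ 1 := by
    intro a ha ha2 t ht hta
    have := congrArg orderS hta
    rw [orderS_mul ht ha, orderS_one] at this
    have := Nat.eq_one_of_mul_eq_one_left this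
    omega
  exact exists_common_left_multiple nonzeroS hf hg
    (fun _ _ _ _ => mul_right_cancel_of_mem_nonzeroS hf)
    (fun _ _ _ _ => mul_right_cancel_of_mem_nonzeroS hg) (hone hf hf2) (hone hg hg2) h

/-- A semigroup of nonzero formal series with zero linear coefficient
(a subsemigroup of `𝔖₂`) either contains a non-cyclic free subsemigroup, or contains a
non-cyclic free abelian subsemigroup, or every pair of its elements satisfies the Levin
relations `fᵏ ∘ gˡ = f²ᵏ` and `gˡ ∘ fᵏ = g²ˡ`. -/
theorem trichotomy_for_S2_semigroups (S : Subsemigroup FormalS)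
    (hnz : ∀ f ∈ S, f.1 ≠ 0)
    (hS2 : ∀ f ∈ S, coeffS f 1 = 0) :
    ContainsFreeSubsemigroup (S : Set FormalS) ∨
    ContainsFreeAbelianSubsemigroup (S : Set FormalS) ∨
    (∀ f ∈ S, ∀ g ∈ S, ∃ k l : ℕ, 1 ≤ k ∧ 1 ≤ l ∧
      f ^ k * g ^ l = f ^ (2 * k) ∧ g ^ l * f ^ k = g ^ (2 * l)) := by
  by_cases hfree : ContainsFreeSubsemigroup (S : Set FormalS)
  · exact Or.inl hfree
  by_cases hab : ContainsFreeAbelianSubsemigroup (S : Set FormalS)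
  · exact Or.inr (Or.inl hab)
  refine Or.inr (Or.inr fun f hfS g hgS => ?_)
  have hT : ∀ a ∈ S, a ∈ nonzeroS := fun a ha => toPowerSeries_ne_zero (hnz a ha)
  have hord : ∀ a ∈ S, 2 ≤ orderS a := fun a ha => two_le_orderS (hT a ha) (hS2 a ha)
  have hnf : ∀ a ∈ S, ∀ b ∈ S, ¬ IsFreePair a b := fun a ha b hb hab =>
    hfree ⟨a, ha, b, hb, hab⟩
  have hcommon : ∀ k : ℕ, ∃ u ∈ nonzeroS, ∃ v ∈ nonzeroS, u * f ^ k = v * g ^ k := by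
    intro k
    obtain rfl | hk := Nat.eq_zero_or_pos k
    · exact ⟨1, one_mem _, 1, one_mem _, by simp⟩
    · have hfk := S.pow_mem_of_pos hfS hk
      have hgk := S.pow_mem_of_pos hgS hk
      exact exists_common_left_multiple_of_not_isFreePair (hT _ hfk) (hT _ hgk) (hord _ hfk)
        (hord _ hgk) (hnf _ hfk _ hgk)
  have hf2 := hord f hfS
  have hg2 := hord g hgS
  obtain ⟨β, hβ, hf, c, hc, hg⟩ :=
    exists_isMonomialIn (hT f hfS) (hT g hgS) hf2 hg2 hcommon
  have hβ0 : β ≠ 0 := by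
    rintro rfl
    simp [natOrder] at hβ
  have h1 : coeff 1 β ≠ 0 := hβ ▸ coeff_natOrder_ne_zero hβ0
  have h0 : constantCoeff β = 0 := by
    rw [← coeff_zero_eq_constantCoeff_apply]
    exact coeff_of_lt_order_toNat 0 (show 0 < natOrder β by omega)
  have hfin : IsOfFinOrder c := by
    by_contra hfin
    exact hnf _ (S.mul_mem hfS hgS) _ (S.mul_mem hgS hfS)
      (isFreePair_of_isMonomialIn hβ hf2 hg2 hf hg hc hfin)
  obtain ⟨n, hn, hcn⟩ := isOfFinOrder_iff_pow_eq_one.mp hfin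
  by_cases hind : ∀ p q, 1 ≤ p → 1 ≤ q → orderS f ^ p ≠ orderS g ^ q
  · exact absurd (containsFreeAbelianSubsemigroup_of_isMonomialIn S hfS hgS h0 h1 (hT f hfS)
      (hT g hgS) hf2 hg2 hf hg hn hcn hind) hab
  · push Not at hind
    obtain ⟨p, q, hp, hq, hpq⟩ := hind
    have hfp : IsMonomialIn β (f ^ p) 1 (orderS f ^ p) := by simpa using hf.pow p
    have hgq := hg.pow q
    rw [← hpq] at hgq
    exact exists_levin_relations h0 h1 hn (by rw [← pow_mul, mul_comm, pow_mul, hcn, one_pow])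
      hp hq hfp hgq

end
end

section
/- Let f and g be entire maps and let n, k ≥ 1 be integers such that f^[n]∘g^[k] = f^[2n] and g^[k]∘f^[n] = g^[2k]. Then f and g share the set of preperiodic points: Prep(f) = Prep(g). -/
open Function

noncomputable section

/-- The set of preperiodic points of `f : ℂ → ℂ` : points `z` with
`f^[m + n] z = f^[m] z` for some `m ≥ 0`, `n ≥ 1`. -/
def Prep (f : ℂ → ℂ) : Set ℂ :=
  {z : ℂ | ∃ m n : ℕ, 1 ≤ n ∧ f^[m + n] z = f^[m] z}

theorem prep_iterate (f : ℂ → ℂ) {n : ℕ} (hn : 1 ≤ n) : Prep f^[n] = Prep f := by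
  ext z
  constructor
  · rintro ⟨m, p, hp, h⟩
    refine ⟨n * m, n * p, Nat.mul_pos hn hp, ?_⟩
    rwa [← Nat.mul_add, iterate_mul, iterate_mul]
  · rintro ⟨m, p, hp, h⟩
    have hper : IsPeriodicPt f p (f^[m] z) := by
      rwa [IsPeriodicPt, IsFixedPt, ← iterate_add_apply, Nat.add_comm]
    have hper' : IsPeriodicPt f (n * p) (f^[n * m] z) := by
      have h' := (hper.const_mul n).apply_iterate (n * m - m)
      rwa [← iterate_add_apply, Nat.sub_add_cancel (Nat.le_mul_of_pos_left m hn)] at h'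
    refine ⟨m, p, hp, ?_⟩
    rw [← iterate_mul, ← iterate_mul, Nat.mul_add, Nat.add_comm, iterate_add_apply]
    exact hper'

theorem comp_iterate_of_comp_eq {α : Type*} {F G : α → α} (h : G ∘ F = G^[2]) (j : ℕ) :
    G ∘ F^[j] = G^[j + 1] := by
  induction j with
  | zero => rfl
  | succ j ih =>
    rw [iterate_succ, ← comp_assoc, ih, iterate_succ, comp_assoc, h, ← iterate_add]

theorem prep_subset_of_comp_eq {F G : ℂ → ℂ} (h : G ∘ F = G^[2]) : Prep F ⊆ Prep G := by
  rintro z ⟨m, p, hp, hz⟩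
  refine ⟨m + 1, p, hp, ?_⟩
  rw [Nat.add_right_comm, ← comp_iterate_of_comp_eq h, ← comp_iterate_of_comp_eq h,
    comp_apply, comp_apply, hz]

/-- Entire maps satisfying the Levin relations
`f^[n] ∘ g^[k] = f^[2n]` and `g^[k] ∘ f^[n] = g^[2k]` share the set of preperiodic
points. -/
theorem shared_preperiodic_points_of_levin_relations (f g : ℂ → ℂ)
    (hf : Differentiable ℂ f) (hg : Differentiable ℂ g)
    (n k : ℕ) (hn : 1 ≤ n) (hk : 1 ≤ k)
    (h1 : f^[n] ∘ g^[k] = f^[2 * n])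
    (h2 : g^[k] ∘ f^[n] = g^[2 * k]) :
    Prep f = Prep g := by
  rw [← prep_iterate f hn, ← prep_iterate g hk]
  rw [Nat.mul_comm, iterate_mul] at h1 h2
  exact (prep_subset_of_comp_eq h2).antisymm (prep_subset_of_comp_eq h1)

end
end

section
/- Let S be a nearly abelian semigroup of non-constant entire maps with commutator set K(S), and let G(S) be the group generated by K(S) inside the affine group of ℂ. Then every element s ∈ S acts on G(S) by semiconjugacy as an endomorphism: for every γ ∈ G(S) there exists γ_s ∈ G(S) such that s∘γ = γ_s∘s. -/
open Function

noncomputable section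

/-- A non-constant entire function has dense range. -/
theorem Differentiable.denseRange_of_not_const {h : ℂ → ℂ} (hd : Differentiable ℂ h)
    (hc : ¬ ∃ c : ℂ, ∀ z : ℂ, h z = c) : DenseRange h := by
  intro c
  by_contra hmem
  rw [Metric.mem_closure_range_iff] at hmem
  push Not at hmem
  obtain ⟨ε, hε, hfar⟩ := hmem
  have hfar' : ∀ z, ε ≤ ‖h z - c‖ := fun z ↦ by
    simpa [dist_eq_norm, norm_sub_rev] using hfar z
  have hne : ∀ z, h z - c ≠ 0 := fun z ↦ norm_pos_iff.1 (hε.trans_le (hfar' z))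
  have hdinv : Differentiable ℂ fun z ↦ (h z - c)⁻¹ := (hd.sub_const c).fun_inv hne
  have hb : Bornology.IsBounded (Set.range fun z ↦ (h z - c)⁻¹) := by
    refine isBounded_iff_forall_norm_le.2 ⟨ε⁻¹, ?_⟩
    rintro _ ⟨z, rfl⟩
    simpa only [norm_inv] using inv_anti₀ hε (hfar' z)
  refine hc ⟨h 0, fun z ↦ ?_⟩
  exact sub_left_injective (inv_injective (hdinv.apply_eq_apply_of_bounded hb z 0))

theorem IsAffine.continuous {γ : ℂ → ℂ} (hγ : IsAffine γ) : Continuous γ := by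
  obtain ⟨a, b, -, h⟩ := hγ
  rw [funext h]
  fun_prop

theorem IsAffine.of_left_inverse {γ δ : Function.End ℂ} (hδ : IsAffine δ) (h : γ * δ = 1) :
    IsAffine γ := by
  obtain ⟨a, b, ha, hab⟩ := hδ
  refine ⟨a⁻¹, -(a⁻¹ * b), inv_ne_zero ha, fun z ↦ ?_⟩
  have hz : δ (a⁻¹ * z - a⁻¹ * b) = z := by
    rw [hab]
    field_simp
    ring
  have hinv : γ (δ (a⁻¹ * z - a⁻¹ * b)) = a⁻¹ * z - a⁻¹ * b := congrFun h _
  rw [hz] at hinv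
  rw [hinv]
  ring

/-- The commutator set is closed under inverses. -/
theorem mem_naCommutatorSet_of_left_inverse {S : Subsemigroup (Function.End ℂ)}
    {γ δ : Function.End ℂ} (hδ : δ ∈ naCommutatorSet S) (h : γ * δ = 1) :
    γ ∈ naCommutatorSet S := by
  obtain ⟨hδ, f, hf, g, hg, hfg⟩ := hδ
  exact ⟨hδ.of_left_inverse h, g, hg, f, hf, by rw [hfg, ← mul_assoc, h, one_mul]⟩

theorem NearlyAbelian.semiconj_of_mem_commutatorSet {S : Subsemigroup (Function.End ℂ)}
    (hna : NearlyAbelian S) {s : Function.End ℂ} (hs : s ∈ S) {γ : Function.End ℂ}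
    (hγ : γ ∈ naCommutatorSet S) : ∃ γ' ∈ naCommutatorGroup S, s * γ = γ' * s := by
  obtain ⟨hγ, f, hf, g, hg, hfg⟩ := hγ
  obtain ⟨α, hα, hsf⟩ := hna.2 (s * f) (mul_mem hs hf) g hg
  obtain ⟨β, hβ, hgs⟩ := hna.2 g hg s hs
  refine ⟨α * β, mul_mem
    (Submonoid.subset_closure (Or.inl ⟨hα, s * f, mul_mem hs hf, g, hg, hsf⟩))
    (Submonoid.subset_closure (Or.inl ⟨hβ, g, hg, s, hs, hgs⟩)), ?_⟩
  have hcomp : s * γ * (g * f) = α * β * s * (g * f) := calc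
    s * γ * (g * f) = s * f * g := by rw [mul_assoc s, ← hfg, mul_assoc]
    _ = α * (g * s * f) := by rw [hsf, mul_assoc g]
    _ = α * β * s * (g * f) := by rw [hgs]; simp only [mul_assoc]
  obtain ⟨hd, hc⟩ := hna.1 (g * f) (mul_mem hg hf)
  have hs' : Continuous s := (hna.1 s hs).1.continuous
  exact (hd.denseRange_of_not_const hc).equalizer (hs'.comp hγ.continuous)
    ((hα.continuous.comp hβ.continuous).comp hs') hcomp

/-- In a nearly abelian semigroup `S` of non-constant entire maps, every
element `s ∈ S` acts on the group `G(S)` generated by the commutator set by semiconjugacy :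
for every `γ ∈ G(S)` there is `γₛ ∈ G(S)` with `s ∘ γ = γₛ ∘ s`. -/
theorem nearly_abelian_semiconjugacy (S : Subsemigroup (Function.End ℂ))
    (hna : NearlyAbelian S) :
    ∀ s ∈ S, ∀ γ ∈ naCommutatorGroup S, ∃ γ' ∈ naCommutatorGroup S, s * γ = γ' * s := by
  intro s hs γ hγ
  induction hγ using Submonoid.closure_induction with
  | mem γ hγ =>
    refine hna.semiconj_of_mem_commutatorSet hs ?_
    rcases hγ with hγ | ⟨δ, hδ, hinv, -⟩
    · exact hγ
    · exact mem_naCommutatorSet_of_left_inverse hδ hinv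
  | one => exact ⟨1, one_mem _, by rw [mul_one, one_mul]⟩
  | mul γ δ _ _ ihγ ihδ =>
    obtain ⟨γ', hγ', hsγ⟩ := ihγ
    obtain ⟨δ', hδ', hsδ⟩ := ihδ
    exact ⟨γ' * δ', mul_mem hγ' hδ', by
      rw [← mul_assoc, hsγ, mul_assoc, hsδ, mul_assoc]⟩

end
end

section
/- Let f(z) = z + 1 − exp(z)/2 and g(z) = f(z) + 2πi. Then f∘g = g∘f, and the maps f^[m]∘g^[n], taken over all pairs (m, n) ∈ ℕ×ℕ with (m, n) ≠ (0, 0), are pairwise distinct; that is, f and g generate a non-cyclic free abelian semigroup under composition. -/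
open Function

noncomputable section

/-- The entire map `f (z) = z + 1 - eᶻ / 2`. -/
def fFatou : ℂ → ℂ :=
  fun z => z + 1 - Complex.exp z / 2

/-- The entire map `g (z) = f (z) + 2πi`. -/
def gFatou : ℂ → ℂ :=
  fun z => fFatou z + 2 * (Real.pi : ℂ) * Complex.I

/-- The translation `z ↦ z + 2πin` commutes with `f`. -/
lemma fFatou_add_nat_mul (z : ℂ) (n : ℕ) :
    fFatou (z + n * (2 * (Real.pi : ℂ) * Complex.I)) =
      fFatou z + n * (2 * (Real.pi : ℂ) * Complex.I) := by
  simp only [fFatou, Complex.exp_add, Complex.exp_nat_mul_two_pi_mul_I]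
  ring

lemma fFatou_iterate_add_nat_mul (z : ℂ) (n m : ℕ) :
    fFatou^[m] (z + n * (2 * (Real.pi : ℂ) * Complex.I)) =
      fFatou^[m] z + n * (2 * (Real.pi : ℂ) * Complex.I) := by
  induction m with
  | zero => rfl
  | succ m ih => rw [iterate_succ_apply', ih, fFatou_add_nat_mul, iterate_succ_apply']

lemma gFatou_iterate (z : ℂ) (n : ℕ) :
    gFatou^[n] z = fFatou^[n] z + n * (2 * (Real.pi : ℂ) * Complex.I) := by
  induction n with
  | zero => simp
  | succ n ih =>
    rw [iterate_succ_apply', ih, gFatou, fFatou_add_nat_mul, iterate_succ_apply']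
    push_cast
    ring

lemma fFatou_iterate_gFatou_iterate (z : ℂ) (m n : ℕ) :
    fFatou^[m] (gFatou^[n] z) =
      fFatou^[m + n] z + n * (2 * (Real.pi : ℂ) * Complex.I) := by
  rw [gFatou_iterate, fFatou_iterate_add_nat_mul, iterate_add_apply]

/-- The restriction of `f` to the real line. -/
def fFatouReal (x : ℝ) : ℝ :=
  x + 1 - Real.exp x / 2

lemma fFatou_ofReal (x : ℝ) : fFatou x = fFatouReal x := by
  simp [fFatou, fFatouReal]

lemma fFatou_iterate_ofReal (x : ℝ) (n : ℕ) : fFatou^[n] x = (fFatouReal^[n] x : ℝ) := by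
  induction n with
  | zero => rfl
  | succ n ih => rw [iterate_succ_apply', ih, fFatou_ofReal, iterate_succ_apply']

lemma lt_fFatouReal {x : ℝ} (hx : x < Real.log 2) : x < fFatouReal x := by
  have h := (Real.lt_log_iff_exp_lt two_pos).1 hx
  unfold fFatouReal
  linarith

lemma fFatouReal_lt_log_two {x : ℝ} (hx : x < Real.log 2) : fFatouReal x < Real.log 2 := by
  have h := Real.add_one_lt_exp (sub_ne_zero.2 hx.ne)
  rw [Real.exp_sub, Real.exp_log two_pos] at h
  unfold fFatouReal
  linarith

/-- Real orbits starting below the attracting fixed point `log 2` are strictly increasing. -/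
lemma strictMono_fFatouReal_iterate {x : ℝ} (hx : x < Real.log 2) :
    StrictMono fun n => fFatouReal^[n] x := by
  have bound (n : ℕ) : fFatouReal^[n] x < Real.log 2 := by
    induction n with
    | zero => exact hx
    | succ n ih =>
      rw [iterate_succ_apply']
      exact fFatouReal_lt_log_two ih
  refine strictMono_nat_of_lt_succ fun n => ?_
  rw [iterate_succ_apply']
  exact lt_fFatouReal (bound n)

/-- The maps `f (z) = z + 1 - eᶻ/2` and `g = f + 2πi` commute and
generate a non-cyclic free abelian semigroup : the maps `f^[m] ∘ g^[n]`, for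
`(m, n) ≠ (0, 0)`, are pairwise distinct. -/
theorem fFatou_gFatou_free_abelian :
    fFatou ∘ gFatou = gFatou ∘ fFatou ∧
    ∀ m n p q : ℕ, (m, n) ≠ (0, 0) → (p, q) ≠ (0, 0) →
      fFatou^[m] ∘ gFatou^[n] = fFatou^[p] ∘ gFatou^[q] → (m, n) = (p, q) := by
  constructor
  · ext z
    simpa [gFatou] using fFatou_add_nat_mul (fFatou z) 1
  · intro m n p q _ _ h
    have h0 := congrFun h ((0 : ℝ) : ℂ)
    simp only [comp_apply, fFatou_iterate_gFatou_iterate, fFatou_iterate_ofReal] at h0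
    have hre := congrArg Complex.re h0
    have him := congrArg Complex.im h0
    simp at hre him
    have hsum := (strictMono_fFatouReal_iterate (Real.log_pos one_lt_two)).injective hre
    ext <;> simp <;> omega

end
end
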